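/- arXiv:math/0410601 — 6 statements merged into one kernel-verified Lean document; each statement's English description precedes it below -/
import Mathlib

section
/- Let a ∈ ℝ and b > 0 with a² ≤ 4b, and let f_{a,b} be the free Meixner density. Then ∫_ℝ f_{a,b}(x) dx = 1; that is, f_{a,b} is a probability density on ℝ. -/
open MeasureTheory

/-- The free Meixner density with parameters `a ∈ ℝ`, `b > 0`, `a² ≤ 4b`:
`f_{a,b}(x) = √(4(1+b) - (x-a)²) / (2π (b x² + a x + 1))` on the interval
`[a - 2√(1+b), a + 2√(1+b)]`, and `0` elsewhere. -/
noncomputable def freeMeixnerDensity (a b : ℝ) (x : ℝ) : ℝ :=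
  if x ∈ Set.Icc (a - 2 * Real.sqrt (1 + b)) (a + 2 * Real.sqrt (1 + b)) then
    Real.sqrt (4 * (1 + b) - (x - a) ^ 2) / (2 * Real.pi * (b * x ^ 2 + a * x + 1))
  else 0

open Complex in
/-- The quadratic `r² - a r z + b z²` has no zeros in the closed unit disc. -/
lemma freeMeixner_quadratic_ne_zero {a b r : ℝ} (hb : 0 < b) (hab : a ^ 2 ≤ 4 * b)
    (hr : b < r ^ 2) {z : ℂ} (hz : ‖z‖ ≤ 1) :
    (r : ℂ) ^ 2 - a * r * z + b * z ^ 2 ≠ 0 := by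
  intro h
  have hre := congrArg re h
  have him := congrArg im h
  simp only [pow_two, sub_re, add_re, mul_re, sub_im, add_im, mul_im, ofReal_re, ofReal_im,
    zero_re, zero_im] at hre him
  have hz2 : z.re * z.re + z.im * z.im ≤ 1 := by
    rw [← normSq_apply, normSq_eq_norm_sq]
    exact pow_le_one₀ (norm_nonneg z) hz
  have hkey : z.im * (2 * b * z.re - a * r) = 0 := by linarith
  have hlin : 2 * b * z.re - a * r = 0 := by
    rcases mul_eq_zero.1 hkey with h0 | h0
    · simp only [h0] at hre
      have : (2 * b * z.re - a * r) ^ 2 + (4 * b - a ^ 2) * r ^ 2 = 0 := by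
        linear_combination 4 * b * hre
      have h1 : 0 ≤ (4 * b - a ^ 2) * r ^ 2 := mul_nonneg (by linarith) (sq_nonneg r)
      exact pow_eq_zero_iff two_ne_zero |>.1 (le_antisymm (by linarith) (sq_nonneg _))
    · exact h0
  have : r ^ 2 = b * (z.re * z.re + z.im * z.im) := by
    linear_combination hre - z.re * hlin
  nlinarith

open Complex in
/-- On the unit circle, the quadratic factors the denominator of the free Meixner density. -/
lemma normSq_freeMeixner_quadratic {a b r : ℝ} (hr : r ^ 2 = 1 + b) (θ : ℝ) :
    normSq ((r : ℂ) ^ 2 - a * r * circleMap 0 1 θ + b * circleMap 0 1 θ ^ 2) =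
      b * (a - 2 * r * Real.cos θ) ^ 2 + a * (a - 2 * r * Real.cos θ) + 1 := by
  obtain rfl : b = r ^ 2 - 1 := by linarith
  have hs : Real.sin θ ^ 2 = 1 - Real.cos θ ^ 2 := Real.sin_sq θ
  have hs4 : Real.sin θ ^ 4 = (1 - Real.cos θ ^ 2) ^ 2 := by rw [← hs]; ring
  rw [circleMap_zero, ofReal_one, one_mul, exp_mul_I, ← ofReal_cos, ← ofReal_sin, normSq_apply]
  simp only [pow_two, sub_re, add_re, mul_re, sub_im, add_im, mul_im, ofReal_re, ofReal_im,
    I_re, I_im]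
  ring_nf
  rw [hs4, hs]
  ring

open Complex in
/-- On the unit circle, the real part of `r² (1 - z²) / (r² - a r z + b z²)`. -/
lemma re_freeMeixner_quotient {a b r : ℝ} (hr : r ^ 2 = 1 + b) (θ : ℝ) :
    ((r : ℂ) ^ 2 * (1 - circleMap 0 1 θ ^ 2) /
      ((r : ℂ) ^ 2 - a * r * circleMap 0 1 θ + b * circleMap 0 1 θ ^ 2)).re =
      2 * r ^ 2 * Real.sin θ ^ 2 /
        (b * (a - 2 * r * Real.cos θ) ^ 2 + a * (a - 2 * r * Real.cos θ) + 1) := by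
  rw [div_re, ← add_div, normSq_freeMeixner_quadratic hr]
  congr 1
  obtain rfl : b = r ^ 2 - 1 := by linarith
  have hs : Real.sin θ ^ 2 = 1 - Real.cos θ ^ 2 := Real.sin_sq θ
  have hs4 : Real.sin θ ^ 4 = (1 - Real.cos θ ^ 2) ^ 2 := by rw [← hs]; ring
  rw [circleMap_zero, ofReal_one, one_mul, exp_mul_I, ← ofReal_cos, ← ofReal_sin]
  simp only [pow_two, sub_re, add_re, mul_re, sub_im, add_im, mul_im, ofReal_re, ofReal_im,
    I_re, I_im, one_re, one_im]
  ring_nf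
  rw [hs4, hs]
  ring

lemma freeMeixner_denominator_pos {a b r : ℝ} (hb : 0 < b) (hab : a ^ 2 ≤ 4 * b)
    (hr : r ^ 2 = 1 + b) (θ : ℝ) :
    0 < b * (a - 2 * r * Real.cos θ) ^ 2 + a * (a - 2 * r * Real.cos θ) + 1 := by
  rw [← normSq_freeMeixner_quadratic hr]
  exact Complex.normSq_pos.2 (freeMeixner_quadratic_ne_zero hb hab (by linarith) (by simp))

/-- The mean value property for `r² (1 - z²) / (r² - a r z + b z²)` on the unit circle. -/
lemma integral_freeMeixner_angle_two_pi {a b r : ℝ} (hb : 0 < b) (hab : a ^ 2 ≤ 4 * b)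
    (hr : r ^ 2 = 1 + b) :
    ∫ θ in (0 : ℝ)..2 * Real.pi, 2 * r ^ 2 * Real.sin θ ^ 2 /
      (b * (a - 2 * r * Real.cos θ) ^ 2 + a * (a - 2 * r * Real.cos θ) + 1) = 2 * Real.pi := by
  have hr0 : (r : ℂ) ≠ 0 := by
    rintro h
    have : r = 0 := by exact_mod_cast h
    subst this
    linarith
  have hne : ∀ z : ℂ, ‖z‖ ≤ 1 → (r : ℂ) ^ 2 - a * r * z + b * z ^ 2 ≠ 0 := fun z hz ↦
    freeMeixner_quadratic_ne_zero hb hab (by linarith) hz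
  have hmean : Real.circleAverage (fun z : ℂ ↦ (r : ℂ) ^ 2 * (1 - z ^ 2) /
      ((r : ℂ) ^ 2 - a * r * z + b * z ^ 2)) 0 1 = 1 := by
    rw [DiffContOnCl.circleAverage]
    · simp [hr0]
    · apply DifferentiableOn.diffContOnCl
      rw [abs_one, closure_ball _ one_ne_zero]
      intro z hz
      exact (DifferentiableAt.div (c := fun z : ℂ ↦ (r : ℂ) ^ 2 * (1 - z ^ 2))
        (d := fun z : ℂ ↦ (r : ℂ) ^ 2 - a * r * z + b * z ^ 2) (by fun_prop) (by fun_prop)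
        (hne z (by simpa using hz))).differentiableWithinAt
  have hint : IntervalIntegrable (fun θ : ℝ ↦ (r : ℂ) ^ 2 * (1 - circleMap 0 1 θ ^ 2) /
      ((r : ℂ) ^ 2 - a * r * circleMap 0 1 θ + b * circleMap 0 1 θ ^ 2))
      volume 0 (2 * Real.pi) := by
    apply Continuous.intervalIntegrable
    exact Continuous.div (by fun_prop) (by fun_prop) fun θ ↦ hne _ (by simp)
  have h := congrArg Complex.re hmean
  rw [Real.circleAverage_def, Complex.real_smul, Complex.re_ofReal_mul, Complex.one_re] at h
  have hre := Complex.reCLM.intervalIntegral_comp_comm hint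
  simp only [Complex.reCLM_apply, re_freeMeixner_quotient hr] at hre
  rw [← hre] at h
  rwa [inv_mul_eq_one₀ Real.two_pi_pos.ne', eq_comm] at h

lemma integral_freeMeixner_angle {a b r : ℝ} (hb : 0 < b) (hab : a ^ 2 ≤ 4 * b)
    (hr : r ^ 2 = 1 + b) :
    ∫ θ in (0 : ℝ)..Real.pi, 2 * r ^ 2 * Real.sin θ ^ 2 /
      (b * (a - 2 * r * Real.cos θ) ^ 2 + a * (a - 2 * r * Real.cos θ) + 1) = Real.pi := by
  have h := integral_freeMeixner_angle_two_pi hb hab hr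
  set f : ℝ → ℝ := fun θ ↦ 2 * r ^ 2 * Real.sin θ ^ 2 /
    (b * (a - 2 * r * Real.cos θ) ^ 2 + a * (a - 2 * r * Real.cos θ) + 1) with hf
  have hc : Continuous f := Continuous.div (by fun_prop) (by fun_prop) fun θ ↦
    (freeMeixner_denominator_pos hb hab hr θ).ne'
  have hsymm : ∀ θ, f (2 * Real.pi - θ) = f θ := fun θ ↦ by
    simp [hf, Real.sin_two_pi_sub, Real.cos_two_pi_sub]
  have hhalf : ∫ θ in Real.pi..2 * Real.pi, f θ = ∫ θ in (0 : ℝ)..Real.pi, f θ := by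
    have := intervalIntegral.integral_comp_sub_left f (2 * Real.pi) (a := 0) (b := Real.pi)
    simp only [hsymm, sub_zero] at this
    rw [this]
    congr 1
    ring
  rw [← intervalIntegral.integral_add_adjacent_intervals (hc.intervalIntegrable 0 Real.pi)
    (hc.intervalIntegrable _ _), hhalf] at h
  linarith

/-- The free Meixner density integrates to `1`. -/
theorem stmt_7 (a b : ℝ) (hb : 0 < b) (hab : a ^ 2 ≤ 4 * b) :
    ∫ x : ℝ, freeMeixnerDensity a b x = 1 := by
  set r := Real.sqrt (1 + b) with hrdef
  have hr : r ^ 2 = 1 + b := Real.sq_sqrt (by linarith)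
  have hr0 : 0 < r := Real.sqrt_pos.2 (by linarith)
  set g : ℝ → ℝ := fun x ↦
    Real.sqrt (4 * (1 + b) - (x - a) ^ 2) / (2 * Real.pi * (b * x ^ 2 + a * x + 1)) with hg
  have hind : freeMeixnerDensity a b = (Set.Icc (a - 2 * r) (a + 2 * r)).indicator g := by
    ext x
    simp only [freeMeixnerDensity, Set.indicator_apply, hg, hrdef]
  rw [hind, integral_indicator measurableSet_Icc, integral_Icc_eq_integral_Ioc,
    ← intervalIntegral.integral_of_le (by linarith)]
  have hsub := intervalIntegral.integral_comp_mul_deriv'' (a := 0) (b := Real.pi)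
    (f := fun θ ↦ a - 2 * r * Real.cos θ) (f' := fun θ ↦ 2 * r * Real.sin θ) (g := g)
    (by fun_prop)
    (fun θ _ ↦ by
      have := ((Real.hasDerivAt_cos θ).const_mul (2 * r)).const_sub a
      simpa using this.hasDerivWithinAt)
    (by fun_prop)
    (by
      rintro _ ⟨θ, -, rfl⟩
      refine (ContinuousAt.div (by fun_prop) (by fun_prop) ?_).continuousWithinAt
      exact mul_ne_zero (by positivity) (freeMeixner_denominator_pos hb hab hr θ).ne')
  simp only [Real.cos_zero, Real.cos_pi, mul_one, mul_neg, sub_neg_eq_add] at hsub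
  rw [← hsub, ← div_self Real.pi_ne_zero]
  nth_rewrite 2 [← integral_freeMeixner_angle hb hab hr]
  rw [← intervalIntegral.integral_div]
  apply intervalIntegral.integral_congr
  intro θ hθ
  rw [Set.uIcc_of_le Real.pi_pos.le] at hθ
  have hsin := Real.sin_nonneg_of_mem_Icc hθ
  have hsqrt : Real.sqrt (4 * (1 + b) - (a - 2 * r * Real.cos θ - a) ^ 2) =
      2 * r * Real.sin θ := by
    rw [← Real.sqrt_sq (show 0 ≤ 2 * r * Real.sin θ by positivity)]
    congr 1
    linear_combination -4 * hr - 4 * r ^ 2 * Real.sin_sq_add_cos_sq θ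
  have hpos := freeMeixner_denominator_pos hb hab hr θ
  simp only [hg, Function.comp_apply, hsqrt]
  field_simp
end

section
/- Let a ∈ ℝ and b > 0 with a² ≤ 4b, and let f_{a,b} be the free Meixner density. Then ∫_ℝ x·f_{a,b}(x) dx = 0 and ∫_ℝ x²·f_{a,b}(x) dx = 1; that is, the free Meixner law with these parameters has mean zero and variance one. -/
open MeasureTheory

/-- At `x = a + 2√(1+b) cos θ`, the factor `b x² + a x + 1` of the denominator of the free Meixner
density is the squared modulus of this quadratic at `w = exp (iθ)`. -/
noncomputable def meixnerQuadratic (a b : ℝ) (w : ℂ) : ℂ :=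
  b * w ^ 2 + (Real.sqrt (1 + b) * a : ℝ) * w + (1 + b : ℝ)

lemma meixnerQuadratic_ne_zero {a b : ℝ} (hb : 0 < b) (hab : a ^ 2 ≤ 4 * b) {w : ℂ}
    (hw : ‖w‖ ≤ 1) : meixnerQuadratic a b w ≠ 0 := by
  intro h
  have hc : Real.sqrt (1 + b) ^ 2 = 1 + b := Real.sq_sqrt (by linarith)
  have hre := congrArg Complex.re h
  have him := congrArg Complex.im h
  have hn : w.re ^ 2 + w.im ^ 2 ≤ 1 := by
    have h1 : ‖w‖ ^ 2 ≤ 1 := pow_le_one₀ (norm_nonneg w) hw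
    rw [Complex.sq_norm, Complex.normSq_apply] at h1
    linarith
  simp only [meixnerQuadratic, Complex.add_re, Complex.add_im, Complex.ofReal_re,
    Complex.ofReal_im, pow_two, Complex.mul_re, Complex.mul_im, Complex.zero_re, Complex.zero_im] at hre him
  set c := Real.sqrt (1 + b)
  have hkey : 2 * b * w.re + c * a = 0 := by
    have h1 : w.im * (2 * b * w.re + c * a) = 0 := by linarith
    rcases mul_eq_zero.mp h1 with h2 | h2
    · rw [h2] at hre
      have h3 : (2 * b * w.re + c * a) ^ 2 + c ^ 2 * (4 * b - a ^ 2) = 0 := by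
        linear_combination 4 * b * hre + 4 * b * hc
      have h4 : 0 ≤ c ^ 2 * (4 * b - a ^ 2) := mul_nonneg (sq_nonneg c) (by linarith)
      exact pow_eq_zero_iff two_ne_zero |>.mp (by nlinarith [sq_nonneg (2 * b * w.re + c * a)])
    · exact h2
  have h5 : b * (w.re ^ 2 + w.im ^ 2) = 1 + b := by linear_combination w.re * hkey - hre
  nlinarith

lemma continuous_div_meixnerQuadratic_circleMap {a b : ℝ} (hb : 0 < b) (hab : a ^ 2 ≤ 4 * b)
    (n : ℕ) :
    Continuous fun θ : ℝ => circleMap 0 1 θ ^ n / meixnerQuadratic a b (circleMap 0 1 θ) := by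
  refine ((continuous_circleMap 0 1).pow n).div ?_
    fun θ => meixnerQuadratic_ne_zero hb hab (by simp)
  unfold meixnerQuadratic
  fun_prop

lemma integral_sin_mul_im_div_meixnerQuadratic {a b : ℝ} (hb : 0 < b) (hab : a ^ 2 ≤ 4 * b)
    (n : ℕ) :
    ∫ θ in 0..2 * Real.pi, Real.sin θ *
      (circleMap 0 1 θ ^ (n + 2) / meixnerQuadratic a b (circleMap 0 1 θ)).im = 0 := by
  have hcirc : (∮ z in C(0, 1), (1 - z ^ 2) / 2 * (z ^ n / meixnerQuadratic a b z)) = 0 := by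
    refine DiffContOnCl.circleIntegral_eq_zero zero_le_one (DifferentiableOn.diffContOnCl ?_)
    intro z hz
    have hz' : ‖z‖ ≤ 1 := by
      simpa using Metric.closure_ball_subset_closedBall hz
    have hP := meixnerQuadratic_ne_zero hb hab hz'
    have hd : DifferentiableAt ℂ (meixnerQuadratic a b) z := by
      unfold meixnerQuadratic
      fun_prop
    exact (DifferentiableAt.mul (by fun_prop)
      ((differentiableAt_id.pow n).div hd hP)).differentiableWithinAt
  have heq : (∮ z in C(0, 1), (1 - z ^ 2) / 2 * (z ^ n / meixnerQuadratic a b z)) =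
      ∫ θ in 0..2 * Real.pi, (Real.sin θ : ℂ) *
        (circleMap 0 1 θ ^ (n + 2) / meixnerQuadratic a b (circleMap 0 1 θ)) := by
    rw [circleIntegral]
    refine intervalIntegral.integral_congr fun θ _ => ?_
    have hw : circleMap 0 1 θ = Complex.cos θ + Complex.sin θ * Complex.I := by
      simp [circleMap, Complex.exp_mul_I]
    have hs : Complex.I * (1 - circleMap 0 1 θ ^ 2) / 2 = Complex.sin θ * circleMap 0 1 θ := by
      rw [hw]
      linear_combination (-Complex.I / 2) * Complex.sin_sq_add_cos_sq (θ : ℂ) +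
        (-Complex.sin θ * Complex.cos θ - Complex.sin θ ^ 2 * Complex.I / 2) * Complex.I_sq
    simp only [deriv_circleMap, smul_eq_mul, Complex.ofReal_sin]
    linear_combination (circleMap 0 1 θ ^ (n + 1) / meixnerQuadratic a b (circleMap 0 1 θ)) * hs
  have hint : IntervalIntegrable (fun θ : ℝ => (Real.sin θ : ℂ) *
      (circleMap 0 1 θ ^ (n + 2) / meixnerQuadratic a b (circleMap 0 1 θ)))
      volume 0 (2 * Real.pi) :=
    ((Complex.continuous_ofReal.comp Real.continuous_sin).mul
      (continuous_div_meixnerQuadratic_circleMap hb hab (n + 2))).intervalIntegrable _ _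
  have him := Complex.imCLM.intervalIntegral_comp_comm hint
  rw [← heq, hcirc] at him
  simpa only [Complex.imCLM_apply, Complex.im_ofReal_mul, Complex.zero_im] using him

lemma normSq_meixnerQuadratic_circleMap {a b : ℝ} (hb : 0 < b) (θ : ℝ) :
    Complex.normSq (meixnerQuadratic a b (circleMap 0 1 θ)) =
      b * (a + 2 * Real.sqrt (1 + b) * Real.cos θ) ^ 2 +
        a * (a + 2 * Real.sqrt (1 + b) * Real.cos θ) + 1 := by
  have hc : Real.sqrt (1 + b) ^ 2 = 1 + b := Real.sq_sqrt (by linarith)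
  have hs := Real.sin_sq_add_cos_sq θ
  have hre : (circleMap 0 1 θ).re = Real.cos θ := by simp [circleMap, Complex.exp_ofReal_mul_I_re]
  have him : (circleMap 0 1 θ).im = Real.sin θ := by simp [circleMap, Complex.exp_ofReal_mul_I_im]
  simp only [meixnerQuadratic, Complex.normSq_apply, Complex.add_re, Complex.add_im,
    Complex.ofReal_re, Complex.ofReal_im, pow_two,
    Complex.mul_re, Complex.mul_im, hre, him]
  set c := Real.sqrt (1 + b)
  clear_value c
  obtain rfl : b = c ^ 2 - 1 := by linarith
  have hs' : Real.sin θ ^ 2 = 1 - Real.cos θ ^ 2 := by linarith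
  ring_nf
  simp only [show Real.sin θ ^ 4 = (Real.sin θ ^ 2) ^ 2 by ring, hs']
  ring

lemma im_sq_div_meixnerQuadratic_circleMap {a b : ℝ} (hb : 0 < b) (θ : ℝ) :
    (circleMap 0 1 θ ^ 2 / meixnerQuadratic a b (circleMap 0 1 θ)).im =
      Real.sqrt (1 + b) * (a + 2 * Real.sqrt (1 + b) * Real.cos θ) * Real.sin θ /
        Complex.normSq (meixnerQuadratic a b (circleMap 0 1 θ)) := by
  have hc : Real.sqrt (1 + b) ^ 2 = 1 + b := Real.sq_sqrt (by linarith)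
  have hs := Real.sin_sq_add_cos_sq θ
  have hre : (circleMap 0 1 θ).re = Real.cos θ := by simp [circleMap, Complex.exp_ofReal_mul_I_re]
  have him : (circleMap 0 1 θ).im = Real.sin θ := by simp [circleMap, Complex.exp_ofReal_mul_I_im]
  rw [Complex.div_im, ← sub_div]
  congr 1
  simp only [meixnerQuadratic, Complex.add_re, Complex.add_im,
    Complex.ofReal_re, Complex.ofReal_im, pow_two,
    Complex.mul_re, Complex.mul_im, hre, him]
  set c := Real.sqrt (1 + b)
  clear_value c
  obtain rfl : b = c ^ 2 - 1 := by linarith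
  have hs' : Real.sin θ ^ 3 = Real.sin θ * (1 - Real.cos θ ^ 2) := by rw [← hs]; ring
  ring_nf
  simp only [hs']
  ring

lemma im_cube_div_meixnerQuadratic_circleMap {a b : ℝ} (hb : 0 < b) (θ : ℝ) :
    (circleMap 0 1 θ ^ 3 / meixnerQuadratic a b (circleMap 0 1 θ)).im =
      (2 * Real.sqrt (1 + b) * (a + 2 * Real.sqrt (1 + b) * Real.cos θ) * Real.cos θ - 1) *
        Real.sin θ / Complex.normSq (meixnerQuadratic a b (circleMap 0 1 θ)) := by
  have hc : Real.sqrt (1 + b) ^ 2 = 1 + b := Real.sq_sqrt (by linarith)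
  have hs := Real.sin_sq_add_cos_sq θ
  have hre : (circleMap 0 1 θ).re = Real.cos θ := by simp [circleMap, Complex.exp_ofReal_mul_I_re]
  have him : (circleMap 0 1 θ).im = Real.sin θ := by simp [circleMap, Complex.exp_ofReal_mul_I_im]
  rw [Complex.div_im, ← sub_div]
  congr 1
  simp only [meixnerQuadratic, Complex.add_re, Complex.add_im,
    Complex.ofReal_re, Complex.ofReal_im, pow_succ,
    pow_zero, one_mul, Complex.mul_re, Complex.mul_im, hre, him]
  set c := Real.sqrt (1 + b)
  clear_value c
  obtain rfl : b = c ^ 2 - 1 := by linarith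
  have hs3 : Real.sin θ ^ 3 = Real.sin θ * (1 - Real.cos θ ^ 2) := by rw [← hs]; ring
  have hs5 : Real.sin θ ^ 5 = Real.sin θ * (1 - Real.cos θ ^ 2) ^ 2 := by rw [← hs]; ring
  ring_nf
  simp only [hs3, hs5]
  ring

lemma integral_mul_freeMeixnerDensity {a b : ℝ} (hb : 0 < b) (hab : a ^ 2 ≤ 4 * b) {g : ℝ → ℝ}
    (hg : Continuous g) :
    ∫ x, g x * freeMeixnerDensity a b x =
      ((1 + b) / Real.pi) * ∫ θ in 0..2 * Real.pi,
        g (a + 2 * Real.sqrt (1 + b) * Real.cos θ) * Real.sin θ ^ 2 /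
          Complex.normSq (meixnerQuadratic a b (circleMap 0 1 θ)) := by
  have hc : Real.sqrt (1 + b) ^ 2 = 1 + b := Real.sq_sqrt (by linarith)
  have hD := fun θ => normSq_meixnerQuadratic_circleMap (a := a) hb θ
  have hD0 : ∀ θ : ℝ, Complex.normSq (meixnerQuadratic a b (circleMap 0 1 θ)) ≠ 0 := fun θ =>
    Complex.normSq_eq_zero.not.mpr (meixnerQuadratic_ne_zero hb hab (by simp))
  simp only [hD] at hD0 ⊢
  have hc0 : 0 ≤ Real.sqrt (1 + b) := Real.sqrt_nonneg _
  set c := Real.sqrt (1 + b) with hcdef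
  set F : ℝ → ℝ := fun x => g x *
    (Real.sqrt (4 * (1 + b) - (x - a) ^ 2) / (2 * Real.pi * (b * x ^ 2 + a * x + 1)))
  set H : ℝ → ℝ := fun θ => g (a + 2 * c * Real.cos θ) * Real.sin θ ^ 2 /
    (b * (a + 2 * c * Real.cos θ) ^ 2 + a * (a + 2 * c * Real.cos θ) + 1)
  have hind : (fun x => g x * freeMeixnerDensity a b x) =
      (Set.Icc (a - 2 * c) (a + 2 * c)).indicator F := by
    ext x
    simp only [freeMeixnerDensity, Set.indicator, F, hcdef]
    split_ifs <;> simp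
  have hHc : Continuous H := by
    refine Continuous.div (by fun_prop) (by fun_prop) hD0
  have hsubst : ∫ θ in 0..Real.pi, (F ∘ fun θ => a + 2 * c * Real.cos θ) θ *
      (2 * c * -Real.sin θ) = ∫ x in (a + 2 * c * Real.cos 0)..(a + 2 * c * Real.cos Real.pi),
        F x := by
    refine intervalIntegral.integral_comp_mul_deriv''
      (f := fun θ => a + 2 * c * Real.cos θ) (by fun_prop)
      (fun θ _ => (((Real.hasDerivAt_cos θ).const_mul (2 * c)).const_add a).hasDerivWithinAt)
      (by fun_prop) ?_
    refine ContinuousOn.mul hg.continuousOn (ContinuousOn.div (by fun_prop) (by fun_prop) ?_)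
    rintro _ ⟨θ, _, rfl⟩
    exact mul_ne_zero (by positivity) (hD0 θ)
  have hpull : ∫ θ in 0..Real.pi, (F ∘ fun θ => a + 2 * c * Real.cos θ) θ *
      (2 * c * -Real.sin θ) = ∫ θ in 0..Real.pi, -(2 * (1 + b) / Real.pi) * H θ := by
    refine intervalIntegral.integral_congr fun θ hθ => ?_
    rw [Set.uIcc_of_le Real.pi_pos.le] at hθ
    have hsin := Real.sin_nonneg_of_mem_Icc hθ
    have hroot : Real.sqrt (4 * (1 + b) - (a + 2 * c * Real.cos θ - a) ^ 2) =
        2 * c * Real.sin θ := by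
      rw [← Real.sqrt_sq (by positivity : 0 ≤ 2 * c * Real.sin θ)]
      congr 1
      linear_combination -4 * hc - 4 * c ^ 2 * Real.sin_sq_add_cos_sq θ
    have hpi := Real.pi_ne_zero
    have hDθ := hD0 θ
    simp only [Function.comp, F, H, hroot]
    rw [← hc]
    field_simp
  have hfold : ∫ θ in 0..2 * Real.pi, H θ = 2 * ∫ θ in 0..Real.pi, H θ := by
    have hrefl := intervalIntegral.integral_comp_sub_left (a := 0) (b := Real.pi) H (2 * Real.pi)
    have hsymm : ∀ θ, H (2 * Real.pi - θ) = H θ := fun θ => by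
      simp only [H, Real.cos_two_pi_sub, Real.sin_two_pi_sub, neg_sq]
    simp only [hsymm, sub_zero, show 2 * Real.pi - Real.pi = Real.pi by ring] at hrefl
    rw [← intervalIntegral.integral_add_adjacent_intervals (hHc.intervalIntegrable 0 Real.pi)
      (hHc.intervalIntegrable _ _), ← hrefl]
    ring
  rw [hind, integral_indicator measurableSet_Icc, integral_Icc_eq_integral_Ioc,
    ← intervalIntegral.integral_of_le (by linarith), intervalIntegral.integral_symm, hfold]
  rw [hpull, Real.cos_zero, Real.cos_pi, mul_one, mul_neg_one, ← sub_eq_add_neg,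
    intervalIntegral.integral_const_mul] at hsubst
  rw [← hsubst]
  ring

/-- The free Meixner law has mean zero and variance one. -/
theorem stmt_8 (a b : ℝ) (hb : 0 < b) (hab : a ^ 2 ≤ 4 * b) :
    (∫ x : ℝ, x * freeMeixnerDensity a b x) = 0 ∧
      (∫ x : ℝ, x ^ 2 * freeMeixnerDensity a b x) = 1 := by
  have hc0 : Real.sqrt (1 + b) ≠ 0 := (Real.sqrt_pos.mpr (by linarith)).ne'
  have hD0 : ∀ θ : ℝ, Complex.normSq (meixnerQuadratic a b (circleMap 0 1 θ)) ≠ 0 := fun θ =>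
    Complex.normSq_eq_zero.not.mpr (meixnerQuadratic_ne_zero hb hab (by simp))
  constructor
  · rw [integral_mul_freeMeixnerDensity hb hab continuous_id']
    have hcongr : ∀ θ : ℝ, (a + 2 * Real.sqrt (1 + b) * Real.cos θ) * Real.sin θ ^ 2 /
        Complex.normSq (meixnerQuadratic a b (circleMap 0 1 θ)) = (Real.sqrt (1 + b))⁻¹ *
        (Real.sin θ * (circleMap 0 1 θ ^ 2 / meixnerQuadratic a b (circleMap 0 1 θ)).im) := by
      intro θ
      have := hD0 θ
      rw [im_sq_div_meixnerQuadratic_circleMap hb]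
      field_simp
    simp only [hcongr]
    rw [intervalIntegral.integral_const_mul,
      integral_sin_mul_im_div_meixnerQuadratic hb hab 0, mul_zero, mul_zero]
  · rw [integral_mul_freeMeixnerDensity hb hab (continuous_pow 2)]
    have hcongr : ∀ θ : ℝ, (a + 2 * Real.sqrt (1 + b) * Real.cos θ) ^ 2 * Real.sin θ ^ 2 /
        Complex.normSq (meixnerQuadratic a b (circleMap 0 1 θ)) = (1 + b)⁻¹ *
        (Real.sin θ * (circleMap 0 1 θ ^ 3 / meixnerQuadratic a b (circleMap 0 1 θ)).im +
          Real.sin θ ^ 2) := by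
      intro θ
      have hDθ := hD0 θ
      have hb1 : 1 + b ≠ 0 := by positivity
      rw [im_cube_div_meixnerQuadratic_circleMap hb]
      field_simp
      rw [normSq_meixnerQuadratic_circleMap hb]
      ring
    simp only [hcongr]
    rw [intervalIntegral.integral_const_mul, intervalIntegral.integral_add,
      integral_sin_mul_im_div_meixnerQuadratic hb hab 1, integral_sin_sq]
    · have := Real.pi_ne_zero
      have hb1 : 1 + b ≠ 0 := by positivity
      simp only [Real.sin_zero, Real.sin_two_pi]
      field_simp
      ring
    · exact (Real.continuous_sin.mul (Complex.continuous_im.comp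
        (continuous_div_meixnerQuadratic_circleMap hb hab 3))).intervalIntegrable _ _
    · exact (Real.continuous_sin.pow 2).intervalIntegrable _ _
end

section
/- Let a ∈ ℝ and b > 0 with a² ≤ 4b, and let f_{a,b} be the free Meixner density. For every complex number z with Im z > 0, the Cauchy–Stieltjes transform G(z) = ∫_ℝ f_{a,b}(x)/(z − x) dx satisfies the quadratic equation (b·z² + a·z + 1)·G(z)² − ((1 + 2b)·z + a)·G(z) + (1 + b) = 0. -/
open MeasureTheory

/-- Spectral factor of the free Meixner denominator: with `b = r² - 1` and `‖w‖ = 1`,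
`b x² + a x + 1 = p(w) p(w⁻¹)` at `x = a + r (w + w⁻¹)`. -/
def meixnerFactor (a r w : ℂ) : ℂ := r ^ 2 + a * r * w + (r ^ 2 - 1) * w ^ 2

/-- Analytic half of the partial fraction decomposition of the Cauchy kernel of the free Meixner
density on the unit circle. -/
noncomputable def meixnerKernel (a r u w : ℂ) : ℂ :=
  (1 - w ^ 2) * (r ^ 2 - u * (r ^ 2 - 1) * w) /
    (meixnerFactor a r u * meixnerFactor a r w * (1 - u * w))

theorem meixnerFactor_mul_inv (a r : ℂ) {w : ℂ} (hw : w ≠ 0) :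
    meixnerFactor a r w * meixnerFactor a r w⁻¹ =
      (r ^ 2 - 1) * (a + r * (w + w⁻¹)) ^ 2 + a * (a + r * (w + w⁻¹)) + 1 := by
  unfold meixnerFactor
  field_simp
  ring

theorem meixnerFactor_ne_zero {a r : ℝ} (hr : 1 < r) (ha : a ^ 2 ≤ 4 * (r ^ 2 - 1)) {w : ℂ}
    (hw : ‖w‖ ≤ 1) : meixnerFactor a r w ≠ 0 := by
  intro h
  have hw2 : w.re ^ 2 + w.im ^ 2 ≤ 1 := by
    have h2 := Complex.sq_norm w
    rw [Complex.normSq_apply] at h2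
    nlinarith [norm_nonneg w]
  have hre := congrArg Complex.re h
  have him := congrArg Complex.im h
  simp [meixnerFactor, pow_two] at hre him
  have hr2 : 0 < r ^ 2 - 1 := by nlinarith
  have hlin : a * r + 2 * (r ^ 2 - 1) * w.re = 0 := by
    by_cases hy : w.im = 0
    · rw [hy] at hre
      have h1 : (a * r + 2 * (r ^ 2 - 1) * w.re) ^ 2 = r ^ 2 * (a ^ 2 - 4 * (r ^ 2 - 1)) := by
        linear_combination 4 * (r ^ 2 - 1) * hre
      have h2 : r ^ 2 * (a ^ 2 - 4 * (r ^ 2 - 1)) ≤ 0 :=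
        mul_nonpos_of_nonneg_of_nonpos (sq_nonneg r) (by linarith)
      exact pow_eq_zero_iff two_ne_zero |>.1 (le_antisymm (h1 ▸ h2) (sq_nonneg _))
    · apply mul_left_cancel₀ hy
      linear_combination him
  have h3 : r ^ 2 = (r ^ 2 - 1) * (w.re ^ 2 + w.im ^ 2) := by
    linear_combination hre - w.re * hlin
  nlinarith [mul_le_mul_of_nonneg_left hw2 hr2.le]

theorem exists_add_inv_eq_of_im_ne_zero {ζ : ℂ} (hζ : ζ.im ≠ 0) :
    ∃ u : ℂ, u ≠ 0 ∧ ‖u‖ < 1 ∧ u + u⁻¹ = ζ := by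
  obtain ⟨s, hs⟩ := IsAlgClosed.exists_pow_nat_eq (ζ ^ 2 - 4) (n := 2) two_pos
  have hv : ((ζ + s) / 2) * ((ζ - s) / 2) = 1 := by linear_combination -hs / 4
  set v := (ζ + s) / 2 with hvdef
  have hv0 : v ≠ 0 := left_ne_zero_of_mul_eq_one hv
  have hinv : v⁻¹ = (ζ - s) / 2 := (eq_inv_of_mul_eq_one_right hv).symm
  have hsum : v + v⁻¹ = ζ := by rw [hinv, hvdef]; ring
  rcases lt_trichotomy ‖v‖ 1 with h | h | h
  · exact ⟨v, hv0, h, hsum⟩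
  · refine absurd ?_ hζ
    rw [← hsum, Complex.inv_eq_conj h]
    simp
  · refine ⟨v⁻¹, inv_ne_zero hv0, ?_, by rw [inv_inv, add_comm, hsum]⟩
    rw [norm_inv]
    exact inv_lt_one_of_one_lt₀ h

theorem meixnerKernel_add_inv {a r u w : ℂ} (hr : r ≠ 0) (hu : u ≠ 0) (hw : w ≠ 0)
    (hpu : meixnerFactor a r u ≠ 0) (hpw : meixnerFactor a r w ≠ 0)
    (hpw' : meixnerFactor a r w⁻¹ ≠ 0) (huw : 1 - u * w ≠ 0) (huw' : 1 - u * w⁻¹ ≠ 0) :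
    -(r * (w - w⁻¹)) ^ 2 /
      (((r ^ 2 - 1) * (a + r * (w + w⁻¹)) ^ 2 + a * (a + r * (w + w⁻¹)) + 1) *
        (a + r * (u + u⁻¹) - (a + r * (w + w⁻¹)))) =
    r * u * (meixnerKernel a r u w + meixnerKernel a r u w⁻¹) := by
  have e2 : a + r * (u + u⁻¹) - (a + r * (w + w⁻¹)) =
      r * ((1 - u * w) * (1 - u * w⁻¹)) / u := by
    field_simp
    ring
  rw [← meixnerFactor_mul_inv a r hw, e2]
  unfold meixnerKernel
  generalize hA : meixnerFactor a r u = A at *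
  generalize hB : meixnerFactor a r w = B at *
  generalize hC : meixnerFactor a r w⁻¹ = C at *
  generalize hD : 1 - u * w = D at *
  generalize hE : 1 - u * w⁻¹ = E at *
  have hmain : -(w - w⁻¹) ^ 2 * A = (1 - w ^ 2) * (r ^ 2 - u * (r ^ 2 - 1) * w) * (C * E) +
      (1 - w⁻¹ ^ 2) * (r ^ 2 - u * (r ^ 2 - 1) * w⁻¹) * (B * D) := by
    subst hA hB hC hD hE
    unfold meixnerFactor
    field_simp
    ring
  have hsplit : (1 - w ^ 2) * (r ^ 2 - u * (r ^ 2 - 1) * w) / (A * B * D) +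
      (1 - w⁻¹ ^ 2) * (r ^ 2 - u * (r ^ 2 - 1) * w⁻¹) / (A * C * E) =
      -(w - w⁻¹) ^ 2 * A / (A * (B * C * (D * E))) := by
    rw [hmain, div_add_div _ _ (by positivity) (by positivity),
      div_eq_div_iff (by positivity) (by positivity)]
    ring
  rw [hsplit, mul_pow]
  generalize w - w⁻¹ = F
  field_simp

theorem one_sub_mul_ne_zero_of_norm_lt_one {u w : ℂ} (hu : ‖u‖ < 1) (hw : ‖w‖ ≤ 1) :
    1 - u * w ≠ 0 := by
  intro h
  have h1 : ‖u * w‖ = 1 := by rw [← sub_eq_zero.1 h, norm_one]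
  rw [norm_mul] at h1
  nlinarith [norm_nonneg u, norm_nonneg w]

theorem differentiableOn_meixnerKernel {a r : ℝ} (hr : 1 < r) (ha : a ^ 2 ≤ 4 * (r ^ 2 - 1)) {u : ℂ}
    (hu : ‖u‖ < 1) : DifferentiableOn ℂ (meixnerKernel a r u) (Metric.closedBall 0 1) := by
  intro w hw
  have hw1 : ‖w‖ ≤ 1 := by simpa using hw
  have hden : meixnerFactor a r u * meixnerFactor a r w * (1 - u * w) ≠ 0 :=
    mul_ne_zero (mul_ne_zero (meixnerFactor_ne_zero hr ha hu.le) (meixnerFactor_ne_zero hr ha hw1))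
      (one_sub_mul_ne_zero_of_norm_lt_one hu hw1)
  unfold meixnerKernel
  unfold meixnerFactor at hden ⊢
  apply DifferentiableAt.differentiableWithinAt
  fun_prop (disch := exact hden)

theorem integral_meixnerKernel {a r : ℝ} (hr : 1 < r) (ha : a ^ 2 ≤ 4 * (r ^ 2 - 1)) {u : ℂ}
    (hu : ‖u‖ < 1) :
    ∫ θ in (0 : ℝ)..Real.pi, (meixnerKernel a r u (Complex.exp (θ * Complex.I)) +
      meixnerKernel a r u (Complex.exp (θ * Complex.I))⁻¹) =
      2 * Real.pi / meixnerFactor a r u := by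
  have hdiff := differentiableOn_meixnerKernel hr ha hu
  have hcont : Continuous fun θ : ℝ => meixnerKernel a r u (Complex.exp (θ * Complex.I)) :=
    hdiff.continuousOn.comp_continuous (by fun_prop) fun θ => by
      simp [Complex.norm_exp_ofReal_mul_I]
  have hcont' : Continuous fun θ : ℝ => meixnerKernel a r u (Complex.exp (θ * Complex.I))⁻¹ := by
    simpa [← Complex.exp_neg, Function.comp_def] using hcont.comp continuous_neg
  have hsub : ∫ θ in (0 : ℝ)..Real.pi, meixnerKernel a r u (Complex.exp (θ * Complex.I))⁻¹ =
      ∫ θ in -Real.pi..0, meixnerKernel a r u (Complex.exp (θ * Complex.I)) := by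
    have h := intervalIntegral.integral_comp_neg (a := 0) (b := Real.pi)
      fun θ : ℝ => meixnerKernel a r u (Complex.exp (θ * Complex.I))
    simpa [Complex.exp_neg] using h
  have hmean := circleAverage_of_differentiable_on_off_countable (c := 0) (R := 1)
    Set.countable_empty (by simpa using hdiff.continuousOn) fun w hw =>
      hdiff.differentiableAt (Filter.mem_of_superset (Metric.isOpen_ball.mem_nhds
        (by simpa using hw)) Metric.ball_subset_closedBall)
  rw [Real.circleAverage_eq_integral_add (-Real.pi),
    intervalIntegral.integral_comp_add_right
      (fun θ => meixnerKernel a r u (circleMap 0 1 θ))] at hmean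
  have hlim : 2 * Real.pi + -Real.pi = Real.pi := by ring
  simp only [zero_add, hlim, circleMap_zero, Complex.ofReal_one, one_mul] at hmean
  rw [intervalIntegral.integral_add (hcont.intervalIntegrable _ _)
    (hcont'.intervalIntegrable _ _), hsub, add_comm,
    intervalIntegral.integral_add_adjacent_intervals (hcont.intervalIntegrable _ _)
    (hcont.intervalIntegrable _ _)]
  have hr0 : (r : ℂ) ≠ 0 := by exact_mod_cast (zero_lt_one.trans hr).ne'
  have hval : meixnerKernel a r u 0 = (meixnerFactor a r u)⁻¹ := by
    have h0 : meixnerFactor a r 0 = (r : ℂ) ^ 2 := by simp [meixnerFactor]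
    simp only [meixnerKernel, h0]
    have := meixnerFactor_ne_zero hr ha hu.le
    field_simp
    simp
  rw [hval, inv_smul_eq_iff₀ (by positivity), Complex.real_smul] at hmean
  rw [hmean]
  push_cast
  rw [div_eq_mul_inv]

/-- The Cauchy transform in the Joukowski coordinate `z = a + r (u + u⁻¹)`, `r = √(1 + b)`. -/
theorem integral_freeMeixnerDensity_div {a b r : ℝ} (hr : 1 < r) (hb : b = r ^ 2 - 1)
    (hab : a ^ 2 ≤ 4 * b) {u : ℂ} (hu0 : u ≠ 0) (hu : ‖u‖ < 1) :
    ∫ x : ℝ, (freeMeixnerDensity a b x : ℂ) / ((a + r * (u + u⁻¹) : ℂ) - x) =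
      r * u / meixnerFactor a r u := by
  subst hb
  have hr0 : 0 < r := zero_lt_one.trans hr
  have hrC : (r : ℂ) ≠ 0 := by exact_mod_cast hr0.ne'
  have hpi : (Real.pi : ℂ) ≠ 0 := by exact_mod_cast Real.pi_ne_zero
  have hsqrt : Real.sqrt (1 + (r ^ 2 - 1)) = r := by
    rw [add_sub_cancel, Real.sqrt_sq hr0.le]
  set g : ℝ → ℂ := fun x =>
    ((Real.sqrt (4 * r ^ 2 - (x - a) ^ 2) / (2 * Real.pi * ((r ^ 2 - 1) * x ^ 2 + a * x + 1)) :
      ℝ) : ℂ) / ((a + r * (u + u⁻¹) : ℂ) - x) with hg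
  have hset : ∫ x : ℝ, (freeMeixnerDensity a (r ^ 2 - 1) x : ℂ) / ((a + r * (u + u⁻¹) : ℂ) - x) =
      ∫ x in (a - 2 * r)..(a + 2 * r), g x := by
    rw [intervalIntegral.integral_of_le (by linarith), ← integral_Icc_eq_integral_Ioc,
      ← integral_indicator measurableSet_Icc]
    congr 1
    ext x
    simp only [freeMeixnerDensity, hsqrt, Set.indicator, hg]
    split_ifs
    · rw [add_sub_cancel]
    · simp
  have hcircle (θ : ℝ) : ((a + 2 * r * Real.cos θ : ℝ) : ℂ) =
      a + r * (Complex.exp (θ * Complex.I) + (Complex.exp (θ * Complex.I))⁻¹) := by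
    rw [← Complex.exp_neg]
    push_cast
    rw [Complex.cos, neg_mul]
    ring
  have hw1 (θ : ℝ) : ‖Complex.exp (θ * Complex.I)‖ ≤ 1 := by simp [Complex.norm_exp_ofReal_mul_I]
  have hw2 (θ : ℝ) : ‖(Complex.exp (θ * Complex.I))⁻¹‖ ≤ 1 := by
    simp [Complex.norm_exp_ofReal_mul_I]
  have hquad (θ : ℝ) : (r ^ 2 - 1) * (a + 2 * r * Real.cos θ) ^ 2 +
      a * (a + 2 * r * Real.cos θ) + 1 ≠ 0 := by
    have h := mul_ne_zero (meixnerFactor_ne_zero hr hab (hw1 θ))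
      (meixnerFactor_ne_zero hr hab (hw2 θ))
    rw [meixnerFactor_mul_inv _ _ (Complex.exp_ne_zero _), ← hcircle] at h
    exact_mod_cast h
  have hsub (θ : ℝ) : (a + r * (u + u⁻¹) : ℂ) - ((a + 2 * r * Real.cos θ : ℝ) : ℂ) ≠ 0 := by
    have h : (a + r * (u + u⁻¹) : ℂ) - ((a + 2 * r * Real.cos θ : ℝ) : ℂ) =
        r * ((1 - u * Complex.exp (θ * Complex.I)) *
          (1 - u * (Complex.exp (θ * Complex.I))⁻¹)) / u := by
      rw [hcircle]
      have := Complex.exp_ne_zero (θ * Complex.I)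
      field_simp
      ring
    rw [h]
    exact div_ne_zero (mul_ne_zero hrC (mul_ne_zero (one_sub_mul_ne_zero_of_norm_lt_one hu (hw1 θ))
      (one_sub_mul_ne_zero_of_norm_lt_one hu (hw2 θ)))) hu0
  have hgcont : ContinuousOn g ((fun θ => a + 2 * r * Real.cos θ) '' Set.uIcc 0 Real.pi) := by
    rintro _ ⟨θ, -, rfl⟩
    apply ContinuousAt.continuousWithinAt
    refine ContinuousAt.div (Complex.continuous_ofReal.continuousAt.comp
      (ContinuousAt.div (by fun_prop) (by fun_prop) ?_)) (by fun_prop) (hsub θ)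
    exact mul_ne_zero (by positivity) (hquad θ)
  have hchange := intervalIntegral.integral_deriv_smul_comp'' (a := 0) (b := Real.pi)
    (f := fun θ => a + 2 * r * Real.cos θ) (f' := fun θ => 2 * r * -Real.sin θ) (g := g)
    (by fun_prop)
    (fun θ _ => (((Real.hasDerivAt_cos θ).const_mul (2 * r)).const_add a).hasDerivWithinAt)
    (by fun_prop) hgcont
  have hend : a + 2 * r * -1 = a - 2 * r := by ring
  simp only [Real.cos_zero, Real.cos_pi, mul_one, hend] at hchange
  rw [hset, intervalIntegral.integral_symm, ← hchange, ← intervalIntegral.integral_neg]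
  have hpoint : ∀ θ ∈ Set.uIcc 0 Real.pi,
      -((2 * r * -Real.sin θ) • (g ∘ fun θ => a + 2 * r * Real.cos θ) θ) =
      r * u / (2 * Real.pi) * (meixnerKernel a r u (Complex.exp (θ * Complex.I)) +
        meixnerKernel a r u (Complex.exp (θ * Complex.I))⁻¹) := by
    intro θ hθ
    rw [Set.uIcc_of_le Real.pi_pos.le] at hθ
    have hsin := Real.sin_nonneg_of_mem_Icc hθ
    have hroot : Real.sqrt (4 * r ^ 2 - (a + 2 * r * Real.cos θ - a) ^ 2) =
        2 * r * Real.sin θ := by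
      rw [← Real.sqrt_sq (by positivity : 0 ≤ 2 * r * Real.sin θ)]
      congr 1
      linear_combination -4 * r ^ 2 * Real.sin_sq_add_cos_sq θ
    have hnum : -(r * (Complex.exp (θ * Complex.I) - (Complex.exp (θ * Complex.I))⁻¹)) ^ 2 =
        ((2 * r * Real.sin θ : ℝ) : ℂ) ^ 2 := by
      rw [← Complex.exp_neg]
      push_cast
      rw [Complex.sin, neg_mul]
      linear_combination (-(r * (Complex.exp (θ * Complex.I) -
        Complex.exp (-(θ * Complex.I)))) ^ 2) * Complex.I_sq
    have hkey := meixnerKernel_add_inv (a := a) hrC hu0 (Complex.exp_ne_zero (θ * Complex.I))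
      (meixnerFactor_ne_zero hr hab hu.le) (meixnerFactor_ne_zero hr hab (hw1 θ))
      (meixnerFactor_ne_zero hr hab (hw2 θ)) (one_sub_mul_ne_zero_of_norm_lt_one hu (hw1 θ))
      (one_sub_mul_ne_zero_of_norm_lt_one hu (hw2 θ))
    rw [hnum, ← hcircle] at hkey
    rw [div_mul_eq_mul_div, ← hkey]
    simp only [hg, Function.comp_apply, hroot, Complex.real_smul]
    push_cast
    generalize ((r : ℂ) ^ 2 - 1) * (a + 2 * r * Complex.cos θ) ^ 2 +
      a * (a + 2 * r * Complex.cos θ) + 1 = Q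
    generalize (a : ℂ) + r * (u + u⁻¹) - (a + 2 * r * Complex.cos θ) = S
    ring
  rw [intervalIntegral.integral_congr hpoint, intervalIntegral.integral_const_mul,
    integral_meixnerKernel hr hab hu]
  field_simp

/-- The Cauchy–Stieltjes transform `G(z) = ∫ f_{a,b}(x)/(z-x) dx` of the free
Meixner law satisfies `(b z² + a z + 1) G² - ((1+2b) z + a) G + (1+b) = 0`
for every `z` in the upper half plane. -/
theorem stmt_9 (a b : ℝ) (hb : 0 < b) (hab : a ^ 2 ≤ 4 * b) (z : ℂ) (hz : 0 < z.im) :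
    ((b : ℂ) * z ^ 2 + (a : ℂ) * z + 1) *
        (∫ x : ℝ, (freeMeixnerDensity a b x : ℂ) / (z - (x : ℂ))) ^ 2
      - (((1 : ℂ) + 2 * (b : ℂ)) * z + (a : ℂ)) *
        (∫ x : ℝ, (freeMeixnerDensity a b x : ℂ) / (z - (x : ℂ)))
      + ((1 : ℂ) + (b : ℂ)) = 0 := by
  obtain ⟨r, hr, rfl⟩ : ∃ r : ℝ, 1 < r ∧ b = r ^ 2 - 1 :=
    ⟨Real.sqrt (1 + b), Real.lt_sqrt_of_sq_lt (by linarith), by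
      rw [Real.sq_sqrt (by linarith)]; ring⟩
  have hr0 : r ≠ 0 := (zero_lt_one.trans hr).ne'
  have hrC : (r : ℂ) ≠ 0 := by exact_mod_cast hr0
  obtain ⟨u, hu0, hu, hz_eq⟩ := exists_add_inv_eq_of_im_ne_zero (ζ := (z - a) / r) (by
    simpa [Complex.div_ofReal_im] using ⟨hz.ne', hr0⟩)
  obtain rfl : z = a + r * (u + u⁻¹) := by
    rw [hz_eq]
    field_simp
    ring
  rw [integral_freeMeixnerDensity_div hr rfl hab hu0 hu]
  have hp := meixnerFactor_ne_zero hr hab hu.le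
  generalize hP : meixnerFactor a r u = P at *
  push_cast
  field_simp
  rw [← hP, meixnerFactor]
  ring
end

section
/- Let a ∈ ℝ and b > 0 with a² ≤ 4b, and let f_{a,b} be the free Meixner density. Define real polynomials by p₀(x) = 1, p₁(x) = x, p₂(x) = x² − a·x − 1, and the recurrence p_{n+1}(x) = (x − a)·p_n(x) − (1 + b)·p_{n−1}(x) for n ≥ 2. Then these polynomials are orthogonal with respect to f_{a,b}: for all natural numbers m ≠ n, ∫_ℝ p_m(x)·p_n(x)·f_{a,b}(x) dx = 0. -/
open MeasureTheory

open Polynomial in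
/-- The Chebyshev polynomials of the second kind, transported to an interval, are orthogonal to
constants with respect to the semicircle weight. -/
theorem integral_chebyshevU_mul_sqrt_eq_zero (a c : ℝ) (hc : 0 < c) (n : ℕ) (hn : n ≠ 0) :
    ∫ x in (a - 2 * c)..(a + 2 * c),
      (Chebyshev.U ℝ n).eval ((x - a) / (2 * c)) * Real.sqrt (4 * c ^ 2 - (x - a) ^ 2) = 0 := by
  have hsub := intervalIntegral.integral_comp_mul_deriv (a := 0) (b := Real.pi)
    (f := fun t => a + 2 * c * Real.cos t) (f' := fun t => 2 * c * -Real.sin t)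
    (g := fun x => (Chebyshev.U ℝ n).eval ((x - a) / (2 * c)) *
      Real.sqrt (4 * c ^ 2 - (x - a) ^ 2))
    (fun t _ => ((Real.hasDerivAt_cos t).const_mul (2 * c)).const_add a)
    (by fun_prop) (by fun_prop)
  have hint : ∫ t in (0 : ℝ)..Real.pi, (2 * c ^ 2 *
      (Real.cos ((n + 2 : ℝ) * t) - Real.cos ((n : ℝ) * t))) = 0 := by
    have h1 : (n : ℝ) ≠ 0 := by exact_mod_cast hn
    have h2 : (n + 2 : ℝ) ≠ 0 := by positivity
    rw [intervalIntegral.integral_const_mul, intervalIntegral.integral_sub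
      (Continuous.intervalIntegrable (by fun_prop) _ _)
      (Continuous.intervalIntegrable (by fun_prop) _ _),
      intervalIntegral.integral_comp_mul_left _ h1,
      intervalIntegral.integral_comp_mul_left _ h2, integral_cos, integral_cos]
    have := Real.sin_nat_mul_pi (n + 2)
    push_cast at this
    simp [Real.sin_nat_mul_pi, this]
  have hcongr : ∫ t in (0 : ℝ)..Real.pi, (2 * c ^ 2 *
      (Real.cos ((n + 2 : ℝ) * t) - Real.cos ((n : ℝ) * t))) =
      ∫ t in (0 : ℝ)..Real.pi, ((fun x => (Chebyshev.U ℝ n).eval ((x - a) / (2 * c)) *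
        Real.sqrt (4 * c ^ 2 - (x - a) ^ 2)) ∘ fun t => a + 2 * c * Real.cos t) t *
        (2 * c * -Real.sin t) := by
    refine intervalIntegral.integral_congr fun t ht => ?_
    rw [Set.uIcc_of_le Real.pi_pos.le] at ht
    have hs : 0 ≤ Real.sin t := Real.sin_nonneg_of_mem_Icc ht
    have hsqrt : Real.sqrt (4 * c ^ 2 - (a + 2 * c * Real.cos t - a) ^ 2) =
        2 * c * Real.sin t := by
      rw [← Real.sqrt_sq (by positivity : 0 ≤ 2 * c * Real.sin t)]
      congr 1
      linear_combination (-4 * c ^ 2) * Real.sin_sq_add_cos_sq t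
    have harg : (a + 2 * c * Real.cos t - a) / (2 * c) = Real.cos t := by
      field_simp
      ring
    have hU := Chebyshev.U_real_cos t n
    have e1 : (n + 2 : ℝ) * t = (n + 1) * t + t := by ring
    have e2 : (n : ℝ) * t = (n + 1) * t - t := by ring
    simp only [Function.comp, hsqrt, harg]
    rw [e1, e2, Real.cos_add, Real.cos_sub]
    push_cast at hU
    linear_combination (4 * c ^ 2 * Real.sin t) * hU
  rw [← hcongr, hint] at hsub
  simp only [Real.cos_pi, Real.cos_zero] at hsub
  rw [intervalIntegral.integral_symm, show a - 2 * c = a + 2 * c * -1 by ring,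
    show a + 2 * c = a + 2 * c * 1 by ring, ← hsub, neg_zero]

theorem eq_zero_of_geometric_of_norm_le {v : ℕ → ℂ} {r : ℂ} {ρ C : ℝ} (hρ : 0 < ρ)
    (hr : ρ < ‖r‖) (hv : ∀ n, v (n + 1) = r * v n) (hC : ∀ n, ‖v n‖ ≤ C * ρ ^ n) (n : ℕ) :
    v n = 0 := by
  have hvn : ∀ n, v n = r ^ n * v 0 := by
    intro n
    induction n with
    | zero => simp
    | succ k ih => rw [hv, ih, pow_succ]; ring
  suffices h0 : v 0 = 0 by rw [hvn, h0, mul_zero]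
  by_contra h0
  have hpos : 0 < ‖v 0‖ := norm_pos_iff.mpr h0
  obtain ⟨k, hk⟩ := pow_unbounded_of_one_lt (C / ‖v 0‖) ((one_lt_div hρ).mpr hr)
  have := hC k
  rw [hvn, norm_mul, norm_pow] at this
  rw [div_pow, div_lt_div_iff₀ hpos (by positivity)] at hk
  linarith

theorem eq_zero_of_recurrence_of_abs_le {a b C : ℝ} (hb : 0 < b) (hab : a ^ 2 ≤ 4 * b)
    {l : ℕ → ℝ}
    (hl : ∀ n, b * l (n + 2) + a * (1 + b) * l (n + 1) + (1 + b) ^ 2 * l n = 0)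
    (hC : ∀ n, |l n| ≤ C * Real.sqrt (1 + b) ^ n) (n : ℕ) : l n = 0 := by
  set s := Real.sqrt (4 * b - a ^ 2) with hs
  have hs2 : s ^ 2 = 4 * b - a ^ 2 := Real.sq_sqrt (by linarith)
  have hs2' : (s : ℂ) ^ 2 = 4 * b - a ^ 2 := by exact_mod_cast hs2
  have hb' : (b : ℂ) ≠ 0 := by exact_mod_cast hb.ne'
  have hc : 0 < Real.sqrt (1 + b) := Real.sqrt_pos.mpr (by linarith)
  have hnorm : ∀ e : ℝ, e ^ 2 = 4 * b - a ^ 2 →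
      Real.sqrt (1 + b) < ‖((1 + b : ℝ) : ℂ) / (2 * b : ℝ) * (-a + e * Complex.I)‖ := by
    intro e he
    refine lt_of_pow_lt_pow_left₀ 2 (norm_nonneg _) ?_
    rw [Real.sq_sqrt (by linarith), norm_mul, norm_div, mul_pow, div_pow,
      Complex.norm_real, Complex.norm_real, ← Complex.normSq_eq_norm_sq (_ + _)]
    have : Complex.normSq (-a + e * Complex.I) = 4 * b := by
      simp [Complex.normSq_apply]
      linarith
    rw [this, Real.norm_eq_abs, Real.norm_eq_abs, sq_abs, sq_abs]
    field_simp
    nlinarith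
  set r : ℂ := ((1 + b : ℝ) : ℂ) / (2 * b : ℝ) * (-a + s * Complex.I) with hr
  set r' : ℂ := ((1 + b : ℝ) : ℂ) / (2 * b : ℝ) * (-a + (-s : ℝ) * Complex.I) with hr'
  have hsum : b * (r + r') = -(a * (1 + b)) := by
    rw [hr, hr']
    push_cast
    field_simp
    ring
  have hprod : b * (r * r') = (1 + b) ^ 2 := by
    rw [hr, hr']
    push_cast
    field_simp
    linear_combination (1 + (b : ℂ)) ^ 2 * (hs2' - (s : ℂ) ^ 2 * Complex.I_sq)
  have hl' : ∀ n, (b : ℂ) * l (n + 2) + a * (1 + b) * l (n + 1) + (1 + b) ^ 2 * l n = 0 := by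
    intro n
    exact_mod_cast hl n
  have hd : ∀ n, (l (n + 1) : ℂ) - r * l n = 0 := by
    refine eq_zero_of_geometric_of_norm_le (v := fun n => (l (n + 1) : ℂ) - r * l n)
      (C := C * (Real.sqrt (1 + b) + ‖r‖)) hc (hnorm (-s) (by rw [neg_sq, hs2])) ?_ ?_
    · intro n
      rw [← hr']
      refine mul_left_cancel₀ hb' ?_
      linear_combination hl' n - (l (n + 1) : ℂ) * hsum + (l n : ℂ) * hprod
    · intro n
      refine (norm_sub_le _ _).trans ?_
      rw [norm_mul, Complex.norm_real, Complex.norm_real, Real.norm_eq_abs, Real.norm_eq_abs]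
      have h1 := hC (n + 1)
      have h2 := mul_le_mul_of_nonneg_left (hC n) (norm_nonneg r)
      rw [pow_succ] at h1
      linarith
  have := eq_zero_of_geometric_of_norm_le (v := fun n => (l n : ℂ)) (C := C) hc (hnorm s hs2)
    (fun n => sub_eq_zero.mp (hd n))
    (fun n => by simpa only [Complex.norm_real, Real.norm_eq_abs] using hC n) n
  exact_mod_cast this

theorem quadratic_pos_of_sq_sub_le {a b x : ℝ} (hb : 0 < b) (hab : a ^ 2 ≤ 4 * b)
    (hx : (x - a) ^ 2 ≤ 4 * (1 + b)) : 0 < b * x ^ 2 + a * x + 1 := by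
  have h4 : 4 * b * (b * x ^ 2 + a * x + 1) = (2 * b * x + a) ^ 2 + (4 * b - a ^ 2) := by ring
  have h0 : 0 ≤ b * x ^ 2 + a * x + 1 := by
    by_contra! h
    nlinarith [sq_nonneg (2 * b * x + a)]
  refine lt_of_le_of_ne h0 fun h => ?_
  rw [← h, mul_zero] at h4
  have h5 : 2 * b * x + a = 0 := by
    have : (2 * b * x + a) ^ 2 = 0 := by nlinarith [sq_nonneg (2 * b * x + a)]
    exact pow_eq_zero_iff two_ne_zero |>.mp this
  have h6 : a * x = -2 := by linear_combination (-2) * h - x * h5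
  have h7 : a ^ 2 = 4 * b := by nlinarith
  have h8 : x ^ 2 ≤ 0 := by nlinarith
  have h9 : x = 0 := by nlinarith
  simp [h9] at h6

theorem sq_sub_le_of_mem_Icc {a b x : ℝ} (hb : 0 < b)
    (hx : x ∈ Set.Icc (a - 2 * Real.sqrt (1 + b)) (a + 2 * Real.sqrt (1 + b))) :
    (x - a) ^ 2 ≤ 4 * (1 + b) := by
  have h : Real.sqrt (1 + b) ^ 2 = 1 + b := Real.sq_sqrt (by linarith)
  nlinarith [hx.1, hx.2]

theorem integrable_mul_indicator_div {a b : ℝ} (hb : 0 < b) (hab : a ^ 2 ≤ 4 * b) {f : ℝ → ℝ}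
    (hf : Continuous f) :
    Integrable ((Set.Icc (a - 2 * Real.sqrt (1 + b)) (a + 2 * Real.sqrt (1 + b))).indicator
      fun x => f x / (2 * Real.pi * (b * x ^ 2 + a * x + 1))) := by
  rw [integrable_indicator_iff measurableSet_Icc]
  refine ContinuousOn.integrableOn_Icc (hf.continuousOn.div (by fun_prop) fun x hx => ?_)
  have := quadratic_pos_of_sq_sub_le hb hab (sq_sub_le_of_mem_Icc hb hx)
  positivity

theorem mul_freeMeixnerDensity (a b : ℝ) (f : ℝ → ℝ) :
    (fun x => f x * freeMeixnerDensity a b x) =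
      (Set.Icc (a - 2 * Real.sqrt (1 + b)) (a + 2 * Real.sqrt (1 + b))).indicator
      fun x => f x * Real.sqrt (4 * (1 + b) - (x - a) ^ 2) /
        (2 * Real.pi * (b * x ^ 2 + a * x + 1)) := by
  ext x
  simp only [freeMeixnerDensity, Set.indicator]
  split_ifs
  · rw [mul_div_assoc]
  · rw [mul_zero]

theorem integrable_mul_freeMeixnerDensity {a b : ℝ} (hb : 0 < b) (hab : a ^ 2 ≤ 4 * b)
    {f : ℝ → ℝ} (hf : Continuous f) :
    Integrable fun x => f x * freeMeixnerDensity a b x := by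
  rw [mul_freeMeixnerDensity]
  exact integrable_mul_indicator_div hb hab (by fun_prop)

theorem integral_quadratic_mul_freeMeixnerDensity {a b : ℝ} (hb : 0 < b) (hab : a ^ 2 ≤ 4 * b)
    (f : ℝ → ℝ) :
    ∫ x, (b * x ^ 2 + a * x + 1) * f x * freeMeixnerDensity a b x =
      (2 * Real.pi)⁻¹ * ∫ x in (a - 2 * Real.sqrt (1 + b))..(a + 2 * Real.sqrt (1 + b)),
        f x * Real.sqrt (4 * (1 + b) - (x - a) ^ 2) := by
  have hc := Real.sqrt_nonneg (1 + b)
  rw [mul_freeMeixnerDensity a b fun x => (b * x ^ 2 + a * x + 1) * f x,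
    integral_indicator measurableSet_Icc, intervalIntegral.integral_of_le (by linarith),
    ← integral_Icc_eq_integral_Ioc, ← integral_const_mul]
  refine setIntegral_congr_fun measurableSet_Icc fun x hx => ?_
  have hq := (quadratic_pos_of_sq_sub_le hb hab (sq_sub_le_of_mem_Icc hb hx)).ne'
  simp only [mul_assoc]
  rw [← mul_assoc 2, mul_comm (2 * Real.pi), mul_div_mul_left _ _ hq, div_eq_inv_mul]

theorem exists_abs_integral_mul_freeMeixnerDensity_le {a b : ℝ} (hb : 0 < b)
    (hab : a ^ 2 ≤ 4 * b) {p : ℕ → ℝ → ℝ} (hcont : ∀ n, Continuous (p n))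
    (hrec : ∀ n x, p (n + 2) x = (x - a) * p (n + 1) x - (1 + b) * p n x) :
    ∃ C, ∀ n, |∫ x, p n x * freeMeixnerDensity a b x| ≤ C * Real.sqrt (1 + b) ^ n := by
  have hc : 0 < Real.sqrt (1 + b) := Real.sqrt_pos.mpr (by linarith)
  have hc2 : Real.sqrt (1 + b) ^ 2 = 1 + b := Real.sq_sqrt (by linarith)
  set K : ℝ → ℝ := fun x => p 1 x ^ 2 - (x - a) * p 0 x * p 1 x + (1 + b) * p 0 x ^ 2 with hK
  have hKcont : Continuous K := by
    have := hcont 0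
    have := hcont 1
    fun_prop
  have hKn : ∀ n x, p (n + 1) x ^ 2 - (x - a) * p n x * p (n + 1) x + (1 + b) * p n x ^ 2 =
      (1 + b) ^ n * K x := by
    intro n x
    induction n with
    | zero => simp [hK]
    | succ k ih => rw [hrec, pow_succ]; linear_combination (1 + b) * ih
  have hG := integrable_mul_indicator_div hb hab (f := fun x => 2 * Real.sqrt (K x)) (by fun_prop)
  refine ⟨∫ x, (Set.Icc (a - 2 * Real.sqrt (1 + b)) (a + 2 * Real.sqrt (1 + b))).indicator
      (fun x => 2 * Real.sqrt (K x) / (2 * Real.pi * (b * x ^ 2 + a * x + 1))) x, fun n => ?_⟩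
  rw [← integral_mul_const, ← Real.norm_eq_abs, mul_freeMeixnerDensity]
  refine norm_integral_le_of_norm_le (hG.mul_const _) (.of_forall fun x => ?_)
  by_cases hx : x ∈ Set.Icc (a - 2 * Real.sqrt (1 + b)) (a + 2 * Real.sqrt (1 + b))
  · have hle := sq_sub_le_of_mem_Icc hb hx
    have hq := quadratic_pos_of_sq_sub_le hb hab hle
    rw [Set.indicator_of_mem hx, Set.indicator_of_mem hx, norm_div, Real.norm_eq_abs,
      Real.norm_of_nonneg (by positivity), div_mul_eq_mul_div]
    gcongr
    have hk := hKn n x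
    have hnn : (4 * (1 + b) - (x - a) ^ 2) * p n x ^ 2 ≤ 4 * ((1 + b) ^ n * K x) := by
      nlinarith [sq_nonneg (2 * p (n + 1) x - (x - a) * p n x)]
    have hK0 : 0 ≤ K x := by
      simp only [hK]
      nlinarith [sq_nonneg (2 * p 1 x - (x - a) * p 0 x),
        mul_nonneg (sub_nonneg.mpr hle) (sq_nonneg (p 0 x))]
    refine abs_le_of_sq_le_sq ?_ (by positivity)
    rw [mul_pow, Real.sq_sqrt (by linarith), mul_pow, mul_pow, Real.sq_sqrt hK0, ← pow_mul,
      mul_comm n, pow_mul, hc2]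
    linarith
  · simp [Set.indicator_of_notMem hx]

open Polynomial in
/-- The free Meixner polynomials of positive degree have mean zero. -/
theorem integral_freeMeixnerPolynomial_eq_zero {a b : ℝ} (hb : 0 < b) (hab : a ^ 2 ≤ 4 * b)
    {p : ℕ → ℝ → ℝ} (hcont : ∀ n, Continuous (p n)) (hp0 : ∀ x, p 0 x = x)
    (hp1 : ∀ x, p 1 x = x ^ 2 - a * x - 1)
    (hrec : ∀ n x, p (n + 2) x = (x - a) * p (n + 1) x - (1 + b) * p n x) (n : ℕ) :
    ∫ x, p n x * freeMeixnerDensity a b x = 0 := by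
  have hc : 0 < Real.sqrt (1 + b) := Real.sqrt_pos.mpr (by linarith)
  have hc2 : Real.sqrt (1 + b) ^ 2 = 1 + b := Real.sq_sqrt (by linarith)
  set c := Real.sqrt (1 + b) with hc_def
  obtain ⟨C, hC⟩ := exists_abs_integral_mul_freeMeixnerDensity_le hb hab hcont hrec
  have hU : ∀ n x, b * p (n + 2) x + a * (1 + b) * p (n + 1) x + (1 + b) ^ 2 * p n x =
      (b * x ^ 2 + a * x + 1) *
        (c ^ (n + 1) * (Chebyshev.U ℝ (n + 1 : ℕ)).eval ((x - a) / (2 * c))) := by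
    intro n x
    induction n using Nat.twoStepInduction with
    | zero =>
      simp only [zero_add, hrec, hp0, hp1, Nat.cast_one, Chebyshev.U_one, eval_mul, eval_X,
        eval_ofNat]
      field_simp
      ring
    | one =>
      simp only [hrec, hp0, hp1, Nat.cast_ofNat, Nat.reduceAdd, Chebyshev.U_two, eval_sub,
        eval_mul, eval_pow, eval_X, eval_ofNat, eval_one]
      field_simp
      rw [hc2]
      ring
    | more k ih1 ih2 =>
      have e := Chebyshev.U_add_two ℝ ((k + 1 : ℕ) : ℤ)
      rw [show ((k + 2 + 1 : ℕ) : ℤ) = ((k + 1 : ℕ) : ℤ) + 2 by push_cast; ring, e,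
        show ((k + 1 : ℕ) : ℤ) + 1 = ((k + 1 + 1 : ℕ) : ℤ) by push_cast; ring]
      simp only [eval_sub, eval_mul, eval_X, eval_ofNat]
      have hy : (x - a) = c * (2 * ((x - a) / (2 * c))) := by field_simp
      have r1 := hrec (k + 2) x
      have r2 := hrec (k + 1) x
      have r3 := hrec k x
      generalize (Chebyshev.U ℝ (k + 1 : ℕ)).eval ((x - a) / (2 * c)) = u at *
      generalize (Chebyshev.U ℝ (k + 1 + 1 : ℕ)).eval ((x - a) / (2 * c)) = v at *
      linear_combination b * r1 + a * (1 + b) * r2 + (1 + b) ^ 2 * r3 + (x - a) * ih2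
        - (1 + b) * ih1 + (b * x ^ 2 + a * x + 1) * c ^ (k + 1) * u * hc2
        + (b * x ^ 2 + a * x + 1) * c ^ (k + 2) * v * hy
  refine eq_zero_of_recurrence_of_abs_le hb hab
    (l := fun n => ∫ x, p n x * freeMeixnerDensity a b x) (fun n => ?_) hC n
  have hi := fun n => integrable_mul_freeMeixnerDensity hb hab (hcont n)
  rw [← integral_const_mul, ← integral_const_mul, ← integral_const_mul,
    ← integral_add ((hi _).const_mul _) ((hi _).const_mul _),
    ← integral_add (((hi _).const_mul _).fun_add ((hi _).const_mul _)) ((hi _).const_mul _)]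
  have hz := integral_quadratic_mul_freeMeixnerDensity hb hab
    fun x => c ^ (n + 1) * (Chebyshev.U ℝ (n + 1 : ℕ)).eval ((x - a) / (2 * c))
  have hch := integral_chebyshevU_mul_sqrt_eq_zero a c hc (n + 1) n.succ_ne_zero
  rw [hc2] at hch
  simp only [mul_assoc (c ^ (n + 1)), intervalIntegral.integral_const_mul] at hz
  rw [← hc_def, hch, mul_zero, mul_zero] at hz
  rw [← hz]
  refine integral_congr_ae (.of_forall fun x => ?_)
  linear_combination freeMeixnerDensity a b x * hU n x

/-- **Orthogonal polynomials of the free Meixner law.** The polynomials defined by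
`p₀ = 1`, `p₁ = x`, `p₂ = x² - a x - 1` and the constant-coefficient recurrence
`p_{n+1}(x) = (x-a) pₙ(x) - (1+b) p_{n-1}(x)` for `n ≥ 2` are orthogonal with
respect to the free Meixner density `f_{a,b}`. -/
theorem stmt_10 (a b : ℝ) (hb : 0 < b) (hab : a ^ 2 ≤ 4 * b)
    (p : ℕ → ℝ → ℝ)
    (hp0 : ∀ x, p 0 x = 1)
    (hp1 : ∀ x, p 1 x = x)
    (hp2 : ∀ x, p 2 x = x ^ 2 - a * x - 1)
    (hrec : ∀ n, 2 ≤ n → ∀ x, p (n + 1) x = (x - a) * p n x - (1 + b) * p (n - 1) x) :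
    ∀ m n : ℕ, m ≠ n → ∫ x : ℝ, p m x * p n x * freeMeixnerDensity a b x = 0 := by
  have hcont : ∀ n, Continuous (p n) := by
    intro n
    induction n using Nat.strong_induction_on with
    | _ n ih =>
      match n, ih with
      | 0, _ => exact (funext hp0 : p 0 = fun _ => 1) ▸ continuous_const
      | 1, _ => exact (funext hp1 : p 1 = fun x => x) ▸ continuous_id
      | 2, _ =>
        rw [(funext hp2 : p 2 = fun x => x ^ 2 - a * x - 1)]
        fun_prop
      | k + 3, ih =>
        have h1 := ih (k + 2) (by lia)
        have h2 := ih (k + 1) (by lia)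
        rw [(funext (hrec (k + 2) (by lia)) : p (k + 3) = _)]
        simp only [Nat.add_one_sub_one]
        fun_prop
  have hmean : ∀ n, ∫ x, p (n + 1) x * freeMeixnerDensity a b x = 0 :=
    integral_freeMeixnerPolynomial_eq_zero hb hab (fun n => hcont (n + 1)) hp1 hp2
      fun n x => hrec (n + 2) (by lia) x
  obtain ⟨α, β, hjac⟩ : ∃ α β : ℕ → ℝ, ∀ n x,
      p (n + 2) x = (x - α n) * p (n + 1) x - β n * p n x := by
    refine ⟨fun _ => a, fun n => if n = 0 then 1 else 1 + b, fun n x => ?_⟩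
    rcases n with _ | n
    · simp only [hp0, hp1, hp2, if_true]
      ring
    · simpa using hrec (n + 2) (by lia) x
  have hi : ∀ m n, Integrable fun x => p m x * p n x * freeMeixnerDensity a b x := fun m n =>
    integrable_mul_freeMeixnerDensity hb hab ((hcont m).mul (hcont n))
  have hlin : ∀ (m n i j k l i' j' : ℕ) (r s t : ℝ),
      (∀ x, p m x * p n x = p i x * p j x + r * (p i x * p k x) + s * (p i x * p l x)
        + t * (p i' x * p j' x)) →
      ∫ x, p i x * p j x * freeMeixnerDensity a b x = 0 →
      ∫ x, p i x * p k x * freeMeixnerDensity a b x = 0 →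
      ∫ x, p i x * p l x * freeMeixnerDensity a b x = 0 →
      ∫ x, p i' x * p j' x * freeMeixnerDensity a b x = 0 →
      ∫ x, p m x * p n x * freeMeixnerDensity a b x = 0 := by
    intro m n i j k l i' j' r s t h h1 h2 h3 h4
    have e : ∀ x, p m x * p n x * freeMeixnerDensity a b x =
        p i x * p j x * freeMeixnerDensity a b x
        + r * (p i x * p k x * freeMeixnerDensity a b x)
        + s * (p i x * p l x * freeMeixnerDensity a b x)
        + t * (p i' x * p j' x * freeMeixnerDensity a b x) := by
      intro x
      rw [h]
      ring
    simp_rw [e]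
    rw [integral_add (((hi _ _).fun_add ((hi _ _).const_mul _)).fun_add ((hi _ _).const_mul _))
        ((hi _ _).const_mul _),
      integral_add ((hi _ _).fun_add ((hi _ _).const_mul _)) ((hi _ _).const_mul _),
      integral_add (hi _ _) ((hi _ _).const_mul _), integral_const_mul, integral_const_mul,
      integral_const_mul, h1, h2, h3, h4]
    simp
  have hlt : ∀ m n, m < n → ∫ x, p m x * p n x * freeMeixnerDensity a b x = 0 := by
    intro m
    induction m using Nat.twoStepInduction with
    | zero =>
      intro n hn
      obtain ⟨n, rfl⟩ := Nat.exists_eq_add_of_lt hn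
      simpa [hp0] using hmean n
    | one =>
      intro n hn
      obtain ⟨n, rfl⟩ := Nat.exists_eq_add_of_lt hn
      rw [show 1 + n + 1 = n + 2 by ring]
      have h0 : ∀ k, ∫ x, p 0 x * p (k + 1) x * freeMeixnerDensity a b x = 0 := fun k => by
        simpa [hp0] using hmean k
      refine hlin 1 (n + 2) 0 (n + 3) (n + 2) (n + 1) 0 (n + 1) (α (n + 1)) (β (n + 1)) 0
        (fun x => ?_) (h0 _) (h0 _) (h0 _) (h0 _)
      rw [hjac (n + 1), hp0, hp1]
      ring
    | more m ih0 ih1 =>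
      intro n hn
      obtain ⟨n, rfl⟩ := Nat.exists_eq_add_of_lt hn
      rw [show m + 2 + n + 1 = m + n + 3 by ring]
      refine hlin (m + 2) (m + n + 3) (m + 1) (m + n + 4) (m + n + 3) (m + n + 2) m (m + n + 3)
        (α (m + n + 2) - α m) (β (m + n + 2)) (-β m) (fun x => ?_) (ih1 _ (by lia))
        (ih1 _ (by lia)) (ih1 _ (by lia)) (ih0 _ (by lia))
      rw [hjac (m + n + 2), hjac m]
      ring
  intro m n hmn
  rcases lt_or_gt_of_ne hmn with h | h
  · exact hlt m n h
  · simpa only [mul_comm (p n _)] using hlt n m h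
end

section
/- Let a ∈ ℝ and b > 0, and let w_{a,b}(x) = √(4b − (x−a)²)/(2πb) for x in [a − 2√b, a + 2√b] and w_{a,b}(x) = 0 otherwise (the semicircle density with mean a and variance b). Then for every natural number n ≥ 0, ∫_ℝ xⁿ·w_{a,b}(x) dx = Σ_{V ∈ NC_{≤2}(n)} a^{s(V)}·b^{|V| − s(V)}, the sum over all noncrossing partitions of {1,…,n} whose blocks have size at most 2, where s(V) is the number of singleton blocks of V and |V| is the number of blocks of V. -/
open MeasureTheory

/-- A finite partition `V` of `{1, …, n}` (modelled as `Fin n` with its natural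
order) is noncrossing if there are no `i₁ < j₁ < i₂ < j₂` with `i₁, i₂` in one
block of `V` and `j₁, j₂` in a different block of `V`. -/
def IsNoncrossing {n : ℕ} (V : Finpartition (Finset.univ : Finset (Fin n))) : Prop :=
  ¬ ∃ i₁ j₁ i₂ j₂ : Fin n, i₁ < j₁ ∧ j₁ < i₂ ∧ i₂ < j₂ ∧
      ∃ B ∈ V.parts, ∃ B' ∈ V.parts, B ≠ B' ∧ i₁ ∈ B ∧ i₂ ∈ B ∧ j₁ ∈ B' ∧ j₂ ∈ B'

/-- The number of singleton blocks of a finite partition. -/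
def singletonCount {n : ℕ} (V : Finpartition (Finset.univ : Finset (Fin n))) : ℕ :=
  (V.parts.filter fun B => B.card = 1).card

/-- `V` is a noncrossing family of pairwise disjoint blocks of size one or two inside `S`, such
that every point of `S` lying strictly between two points of a block is itself in some block. -/
structure IsPartialMatching {α : Type*} [LinearOrder α] (S : Finset α) (V : Finset (Finset α)) :
    Prop where
  subset : ∀ B ∈ V, B ⊆ S
  nonempty : ∀ B ∈ V, B.Nonempty
  card_le : ∀ B ∈ V, B.card ≤ 2
  eq_of_mem : ∀ B ∈ V, ∀ B' ∈ V, ∀ x ∈ B, x ∈ B' → B = B'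
  noncrossing : ∀ i j k l, i < j → j < k → k < l → ∀ B ∈ V, ∀ B' ∈ V,
    i ∈ B → k ∈ B → j ∈ B' → l ∈ B' → B = B'
  covered : ∀ i j k, i < j → j < k → j ∈ S → ∀ B ∈ V, i ∈ B → k ∈ B → ∃ B' ∈ V, j ∈ B'

/-- The points of `S` that lie in no block of `V`. -/
def freePoints {α : Type*} [DecidableEq α] (S : Finset α) (V : Finset (Finset α)) : Finset α :=
  S.filter fun y => ∀ B ∈ V, y ∉ B

theorem mem_freePoints {α : Type*} [DecidableEq α] {S : Finset α} {V : Finset (Finset α)} {y : α} :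
    y ∈ freePoints S V ↔ y ∈ S ∧ ∀ B ∈ V, y ∉ B :=
  Finset.mem_filter

namespace IsPartialMatching

variable {α : Type*} [LinearOrder α] {S : Finset α} {V : Finset (Finset α)} {x : α}

theorem filter_notMem (h : IsPartialMatching (insert x S) V) (hx : ∀ y ∈ S, y < x) :
    IsPartialMatching S (V.filter fun B => x ∉ B) := by
  obtain ⟨h1, h2, h3, h4, h5, h6⟩ := h
  constructor
  · intro B hB y hy
    have := h1 B (by grind) hy
    grind
  · grind
  · grind
  · grind
  · intro i j k l hij hjk hkl B hB B' hB'
    exact h5 i j k l hij hjk hkl B (by grind) B' (by grind)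
  · intro i j k hij hjk hj B hB hi hk
    obtain ⟨B', hB', hjB'⟩ := h6 i j k hij hjk (by grind) B (by grind) hi hk
    refine ⟨B', ?_, hjB'⟩
    simp only [Finset.mem_filter] at hB ⊢
    refine ⟨hB', fun hxB' => hB.2 ?_⟩
    have hkS : k ∈ insert x S := h1 B hB.1 hk
    have hkx : k < x := hx k (by grind)
    rw [h5 i j k x hij hjk hkx B hB.1 B' hB' hi hk hjB' hxB']
    exact hxB'

theorem insert_right (h : IsPartialMatching S V) (hx : ∀ y ∈ S, y < x) :
    IsPartialMatching (insert x S) V := by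
  obtain ⟨h1, h2, h3, h4, h5, h6⟩ := h
  refine ⟨fun B hB => (h1 B hB).trans (Finset.subset_insert _ _), h2, h3, h4, h5, ?_⟩
  intro i j k hij hjk hj B hB hi hk
  have := hx k (h1 B hB hk)
  exact h6 i j k hij hjk (by grind) B hB hi hk

theorem insert_singleton (h : IsPartialMatching S V) (hx : ∀ y ∈ S, y < x) :
    IsPartialMatching (insert x S) (insert {x} V) := by
  obtain ⟨h1, h2, h3, h4, h5, h6⟩ := h
  have h0 : ∀ B ∈ V, ∀ y ∈ B, y < x := fun B hB y hy => hx y (h1 B hB hy)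
  constructor
  · intro B hB y hy
    rcases Finset.mem_insert.1 hB with rfl | hB
    · grind
    · exact Finset.mem_insert_of_mem (h1 B hB hy)
  · grind
  · grind
  · grind
  · intro i j k l hij hjk hkl B hB B' hB' hi hk hj hl
    rcases Finset.mem_insert.1 hB with rfl | hB
    · grind
    rcases Finset.mem_insert.1 hB' with rfl | hB'
    · grind
    exact h5 i j k l hij hjk hkl B hB B' hB' hi hk hj hl
  · intro i j k hij hjk hj B hB hi hk
    rcases Finset.mem_insert.1 hB with rfl | hB
    · grind
    have := h0 B hB k hk
    obtain ⟨B', hB', h⟩ := h6 i j k hij hjk (by grind) B hB hi hk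
    exact ⟨B', Finset.mem_insert_of_mem hB', h⟩

theorem insert_pair (h : IsPartialMatching S V) (hx : ∀ y ∈ S, y < x) {m : α}
    (hm : m ∈ freePoints S V) (hmax : ∀ y ∈ freePoints S V, y ≤ m) :
    IsPartialMatching (insert x S) (insert {m, x} V) := by
  obtain ⟨h1, h2, h3, h4, h5, h6⟩ := h
  have h0 : ∀ B ∈ V, ∀ y ∈ B, y < x := fun B hB y hy => hx y (h1 B hB hy)
  simp only [mem_freePoints] at hm hmax
  have hmx := hx m hm.1
  constructor
  · intro B hB y hy
    rcases Finset.mem_insert.1 hB with rfl | hB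
    · grind
    · exact Finset.mem_insert_of_mem (h1 B hB hy)
  · grind
  · intro B hB
    rcases Finset.mem_insert.1 hB with rfl | hB
    · exact Finset.card_le_two
    · exact h3 B hB
  · intro B hB B' hB' y hy hy'
    rcases Finset.mem_insert.1 hB with rfl | hB <;>
    rcases Finset.mem_insert.1 hB' with rfl | hB'
    · rfl
    · grind
    · grind
    · exact h4 B hB B' hB' y hy hy'
  · intro i j k l hij hjk hkl B hB B' hB' hi hk hj hl
    rcases Finset.mem_insert.1 hB with rfl | hBV <;>
    rcases Finset.mem_insert.1 hB' with rfl | hBV'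
    · rfl
    · simp only [Finset.mem_insert, Finset.mem_singleton] at hi hk
      have := h0 B' hBV' l hl
      clear h1 h2 h3 h4 h5 h6 h0 hmax
      grind
    · have := h0 B hBV k hk
      have hj : j = m := by
        simp only [Finset.mem_insert, Finset.mem_singleton] at hj
        clear h1 h2 h3 h4 h5 h6 h0 hmax
        grind
      subst hj
      obtain ⟨B', hB', h⟩ := h6 i j k hij hjk hm.1 B hBV hi hk
      exact absurd h (hm.2 B' hB')
    · exact h5 i j k l hij hjk hkl B hBV B' hBV' hi hk hj hl
  · intro i j k hij hjk hj B hB hi hk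
    rcases Finset.mem_insert.1 hB with rfl | hB
    · simp only [Finset.mem_insert, Finset.mem_singleton] at hi hk hj
      have hmj : m < j ∧ j < x := by
        clear h1 h2 h3 h4 h5 h6 h0 hmax
        grind
      by_contra! hcon
      exact (hmax j ⟨hj.resolve_left hmj.2.ne,
        fun B hB => hcon B (Finset.mem_insert_of_mem hB)⟩).not_gt hmj.1
    have := h0 B hB k hk
    obtain ⟨B', hB', h⟩ := h6 i j k hij hjk (by grind) B hB hi hk
    exact ⟨B', Finset.mem_insert_of_mem hB', h⟩

theorem exists_eq_insert_pair (h : IsPartialMatching (insert x S) V) (hx : ∀ y ∈ S, y < x)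
    {B : Finset α} (hB : B ∈ V) (hxB : x ∈ B) (hne : B ≠ {x}) :
    ∃ m, m ∈ freePoints S (V.filter fun B => x ∉ B) ∧
      (∀ y ∈ freePoints S (V.filter fun B => x ∉ B), y ≤ m) ∧
      V = insert {m, x} (V.filter fun B => x ∉ B) := by
  obtain ⟨h1, h2, h3, h4, h5, h6⟩ := h
  obtain ⟨m, hmB, hmx⟩ : ∃ m ∈ B, m ≠ x := by
    by_contra! hcon
    exact hne (Finset.eq_singleton_iff_unique_mem.2 ⟨hxB, hcon⟩)
  have hBeq : {m, x} = B := Finset.eq_of_subset_of_card_le (by grind)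
    (by rw [Finset.card_pair hmx]; exact h3 B hB)
  have hmS : m ∈ S := by
    have := h1 B hB hmB
    grind
  refine ⟨m, ?_, ?_, ?_⟩
  · simp only [mem_freePoints, Finset.mem_filter]
    refine ⟨hmS, fun B' hB' hm' => hB'.2 ?_⟩
    rwa [h4 B' hB'.1 B hB m hm' hmB]
  · intro y hy
    simp only [mem_freePoints, Finset.mem_filter] at hy
    by_contra! hlt
    obtain ⟨B', hB', hyB'⟩ := h6 m y x hlt (hx y hy.1) (by grind) B hB hmB hxB
    have hxB' : x ∈ B' := by
      by_contra hxB'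
      exact hy.2 B' ⟨hB', hxB'⟩ hyB'
    have := h4 B' hB' B hB x hxB' hxB
    have := hx y hy.1
    grind
  · ext C
    rw [hBeq]
    simp only [Finset.mem_insert, Finset.mem_filter]
    constructor
    · intro hC
      by_cases hxC : x ∈ C
      · exact Or.inl (h4 C hC B hB x hxC hxB)
      · exact Or.inr ⟨hC, hxC⟩
    · rintro (rfl | hC)
      · exact hB
      · exact hC.1

end IsPartialMatching

section FreePoints

variable {α : Type*} [LinearOrder α] {S : Finset α} {V : Finset (Finset α)} {x : α}

theorem freePoints_insert_right (h : IsPartialMatching S V) (hx : x ∉ S) :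
    freePoints (insert x S) V = insert x (freePoints S V) :=
  Finset.filter_insert .. |>.trans (if_pos fun B hB hxB => hx (h.subset B hB hxB))

theorem freePoints_insert_singleton (hx : x ∉ S) :
    freePoints (insert x S) (insert {x} V) = freePoints S V := by
  ext y
  simp only [mem_freePoints, Finset.mem_insert, forall_eq_or_imp,
    Finset.mem_singleton]
  grind

theorem freePoints_insert_pair (hx : x ∉ S) (m : α) :
    freePoints (insert x S) (insert {m, x} V) = (freePoints S V).erase m := by
  ext y
  simp only [mem_freePoints, Finset.mem_insert, forall_eq_or_imp,
    Finset.mem_singleton, Finset.mem_erase]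
  grind

end FreePoints

open Classical in
/-- The finset of all noncrossing partial matchings of `S`. -/
noncomputable def partialMatchings {α : Type*} [LinearOrder α] (S : Finset α) :
    Finset (Finset (Finset α)) :=
  S.powerset.powerset.filter (IsPartialMatching S)

theorem mem_partialMatchings {α : Type*} [LinearOrder α] {S : Finset α}
    {V : Finset (Finset α)} : V ∈ partialMatchings S ↔ IsPartialMatching S V := by
  simp only [partialMatchings, Finset.mem_filter, Finset.mem_powerset, and_iff_right_iff_imp]
  exact fun h B hB => Finset.mem_powerset.2 (h.subset B hB)

theorem partialMatchings_empty {α : Type*} [LinearOrder α] :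
    partialMatchings (∅ : Finset α) = {∅} := by
  ext V
  rw [mem_partialMatchings, Finset.mem_singleton]
  constructor
  · intro h
    rw [Finset.eq_empty_iff_forall_notMem]
    intro B hB
    exact (h.nonempty B hB).ne_empty (Finset.subset_empty.1 (h.subset B hB))
  · rintro rfl
    constructor <;> simp

theorem filter_notMem_insert {α : Type*} [LinearOrder α] {S : Finset α} {V : Finset (Finset α)}
    {x : α} (h : IsPartialMatching S V) (hx : x ∉ S) {B : Finset α} (hB : x ∈ B) :
    (insert B V).filter (fun B => x ∉ B) = V := by
  rw [Finset.filter_insert, if_neg (not_not.2 hB), Finset.filter_true_of_mem]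
  exact fun C hC hxC => hx (h.subset C hC hxC)

open Classical in
theorem sum_partialMatchings_insert {α : Type*} [LinearOrder α] {S : Finset α} {x : α}
    (hx : ∀ y ∈ S, y < x) (m : Finset (Finset α) → α)
    (hm : ∀ V, (freePoints S V).Nonempty → IsGreatest (freePoints S V : Set α) (m V))
    (F : Finset (Finset α) → ℝ) :
    ∑ V ∈ partialMatchings (insert x S), F V =
      ∑ V ∈ partialMatchings S, (F V + F (insert {x} V) +
        if (freePoints S V).Nonempty then F (insert {m V, x} V) else 0) := by
  have hxS : x ∉ S := fun h => (hx x h).false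
  rw [Finset.sum_add_distrib, Finset.sum_add_distrib, ← Finset.sum_filter,
    ← Finset.sum_filter_add_sum_filter_not _ (fun V => ∀ B ∈ V, x ∉ B), add_assoc,
    ← Finset.sum_filter_add_sum_filter_not (Finset.filter (fun V => ¬ ∀ B ∈ V, x ∉ B) _)
      (fun V => {x} ∈ V)]
  congr 1
  · refine Finset.sum_congr ?_ fun _ _ => rfl
    ext V
    rw [Finset.mem_filter, mem_partialMatchings, mem_partialMatchings]
    constructor
    · rintro ⟨h, hV⟩
      have := h.filter_notMem hx
      rwa [Finset.filter_true_of_mem hV] at this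
    · exact fun h => ⟨h.insert_right hx, fun B hB hxB => hxS (h.subset B hB hxB)⟩
  congr 1
  · have hinv : ∀ V, IsPartialMatching (insert x S) V → {x} ∈ V →
        insert {x} (V.filter fun B => x ∉ B) = V := by
      intro V hV hxV
      ext C
      simp only [Finset.mem_insert, Finset.mem_filter]
      constructor
      · rintro (rfl | hC)
        exacts [hxV, hC.1]
      · intro hC
        by_cases hxC : x ∈ C
        · exact Or.inl (hV.eq_of_mem C hC _ hxV x hxC (Finset.mem_singleton_self x))
        · exact Or.inr ⟨hC, hxC⟩
    refine Finset.sum_nbij' (fun V => V.filter fun B => x ∉ B) (fun V => insert {x} V)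
      ?_ ?_ ?_ ?_ ?_
    · intro V hV
      simp only [Finset.mem_filter, mem_partialMatchings] at hV ⊢
      exact hV.1.1.filter_notMem hx
    · intro V hV
      simp only [Finset.mem_filter, mem_partialMatchings] at hV ⊢
      refine ⟨⟨hV.insert_singleton hx, fun h => ?_⟩, Finset.mem_insert_self _ _⟩
      exact h _ (Finset.mem_insert_self _ _) (Finset.mem_singleton_self x)
    · intro V hV
      simp only [Finset.mem_filter, mem_partialMatchings] at hV
      exact hinv V hV.1.1 hV.2
    · intro V hV
      exact filter_notMem_insert (mem_partialMatchings.1 hV) hxS (Finset.mem_singleton_self x)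
    · intro V hV
      simp only [Finset.mem_filter, mem_partialMatchings] at hV
      rw [hinv V hV.1.1 hV.2]
  · have hinv : ∀ V, IsPartialMatching (insert x S) V → (¬ ∀ B ∈ V, x ∉ B) → {x} ∉ V →
        (freePoints S (V.filter fun B => x ∉ B)).Nonempty ∧
        insert {m (V.filter fun B => x ∉ B), x} (V.filter fun B => x ∉ B) = V := by
      intro V hV hxV hxs
      push Not at hxV
      obtain ⟨B, hB, hxB⟩ := hxV
      obtain ⟨y, hy, hmax, hVy⟩ := hV.exists_eq_insert_pair hx hB hxB fun h => hxs (h ▸ hB)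
      have hne : (freePoints S (V.filter fun B => x ∉ B)).Nonempty := ⟨y, hy⟩
      have : y = m (V.filter fun B => x ∉ B) :=
        IsGreatest.unique ⟨Finset.mem_coe.2 hy, hmax⟩ (hm _ hne)
      exact ⟨hne, this ▸ hVy.symm⟩
    refine Finset.sum_nbij' (fun V => V.filter fun B => x ∉ B) (fun V => insert {m V, x} V)
      ?_ ?_ ?_ ?_ ?_
    · intro V hV
      simp only [Finset.mem_filter, mem_partialMatchings] at hV ⊢
      exact ⟨hV.1.1.filter_notMem hx, (hinv V hV.1.1 hV.1.2 hV.2).1⟩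
    · intro V hV
      simp only [Finset.mem_filter, mem_partialMatchings] at hV ⊢
      obtain ⟨hmem, hmax⟩ := hm V hV.2
      have hmS : m V ∈ S := (mem_freePoints.1 hmem).1
      refine ⟨⟨hV.1.insert_pair hx hmem hmax, fun h => ?_⟩, fun h => ?_⟩
      · exact h _ (Finset.mem_insert_self _ _) (by simp)
      · rcases Finset.mem_insert.1 h with h | h
        · have : m V ∈ ({x} : Finset α) := h ▸ Finset.mem_insert_self _ _
          exact (hx _ hmS).ne (Finset.mem_singleton.1 this)
        · exact hxS (hV.1.subset _ h (Finset.mem_singleton_self x))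
    · intro V hV
      simp only [Finset.mem_filter, mem_partialMatchings] at hV
      exact (hinv V hV.1.1 hV.1.2 hV.2).2
    · intro V hV
      simp only [Finset.mem_filter, mem_partialMatchings] at hV
      exact filter_notMem_insert hV.1 hxS (by simp)
    · intro V hV
      simp only [Finset.mem_filter, mem_partialMatchings] at hV
      rw [(hinv V hV.1.1 hV.1.2 hV.2).2]

/-- The monic orthogonal polynomials of the semicircle law with mean `a` and variance `b`,
evaluated at `t`. -/
def semicirclePoly (a b t : ℝ) : ℕ → ℝ
  | 0 => 1
  | 1 => t - a
  | n + 2 => (t - a) * semicirclePoly a b t (n + 1) - b * semicirclePoly a b t n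

theorem continuous_semicirclePoly (a b : ℝ) (n : ℕ) :
    Continuous fun t => semicirclePoly a b t n := by
  induction n using Nat.twoStepInduction with
  | zero => exact continuous_const
  | one => exact continuous_id.sub continuous_const
  | more n h0 h1 => exact ((continuous_id.sub continuous_const).mul h1).sub (h0.const_smul b)

theorem semicirclePoly_cos_mul_sin (a c θ : ℝ) (n : ℕ) :
    semicirclePoly a (c ^ 2) (a + 2 * c * Real.cos θ) n * Real.sin θ =
      c ^ n * Real.sin ((n + 1) * θ) := by
  induction n using Nat.twoStepInduction with
  | zero => simp [semicirclePoly]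
  | one =>
    simp only [semicirclePoly, Nat.cast_one, one_add_one_eq_two, Real.sin_two_mul]
    ring
  | more n h0 h1 =>
    have h : Real.sin ((n + 2 + 1) * θ) + Real.sin ((n + 1) * θ) =
        2 * Real.cos θ * Real.sin ((n + 1 + 1) * θ) := by
      rw [show ((n : ℝ) + 2 + 1) * θ = (n + 1 + 1) * θ + θ by ring,
        show ((n : ℝ) + 1) * θ = (n + 1 + 1) * θ - θ by ring, Real.sin_add, Real.sin_sub]
      ring
    push_cast at h1 ⊢
    simp only [semicirclePoly]
    linear_combination 2 * c * Real.cos θ * h1 - c ^ 2 * h0 - c ^ (n + 2) * h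

theorem integral_sin_mul_sin (n : ℕ) :
    ∫ θ in (0 : ℝ)..Real.pi, Real.sin ((n + 1) * θ) * Real.sin θ =
      if n = 0 then Real.pi / 2 else 0 := by
  have hcos : ∀ k : ℕ, ∫ θ in (0 : ℝ)..Real.pi, Real.cos (k * θ) =
      if k = 0 then Real.pi else 0 := by
    intro k
    split_ifs with hk
    · simp [hk]
    · have hk' : (k : ℝ) ≠ 0 := Nat.cast_ne_zero.2 hk
      rw [intervalIntegral.integral_comp_mul_left (fun x => Real.cos x) hk', integral_cos]
      simp
  have h : ∀ θ : ℝ, Real.sin ((n + 1) * θ) * Real.sin θ =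
      (1 / 2) * (Real.cos ((n : ℕ) * θ) - Real.cos ((n + 2 : ℕ) * θ)) := by
    intro θ
    rw [show ((n : ℕ) : ℝ) * θ = (n + 1) * θ - θ by ring,
      show ((n + 2 : ℕ) : ℝ) * θ = (n + 1) * θ + θ by push_cast; ring, Real.cos_sub, Real.cos_add]
    ring
  simp_rw [h]
  rw [intervalIntegral.integral_const_mul, intervalIntegral.integral_sub, hcos, hcos]
  · rw [if_neg (Nat.succ_ne_zero (n + 1))]
    split_ifs <;> ring
  all_goals exact (by fun_prop : Continuous _).intervalIntegrable _ _

theorem integral_semicirclePoly {a c : ℝ} (hc : 0 < c) (n : ℕ) :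
    ∫ t in (a - 2 * c)..(a + 2 * c), semicirclePoly a (c ^ 2) t n *
        (Real.sqrt (4 * c ^ 2 - (t - a) ^ 2) / (2 * Real.pi * c ^ 2)) =
      if n = 0 then 1 else 0 := by
  have hsub := intervalIntegral.integral_comp_mul_deriv (a := 0) (b := Real.pi)
    (f := fun θ => a + 2 * c * Real.cos θ) (f' := fun θ => 2 * c * -Real.sin θ)
    (g := fun t => semicirclePoly a (c ^ 2) t n *
        (Real.sqrt (4 * c ^ 2 - (t - a) ^ 2) / (2 * Real.pi * c ^ 2)))
    (fun θ _ => ((Real.hasDerivAt_cos θ).const_mul (2 * c)).const_add a)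
    (by fun_prop)
    ((continuous_semicirclePoly a (c ^ 2) n).mul (by fun_prop))
  simp only [Real.cos_zero, Real.cos_pi] at hsub
  rw [intervalIntegral.integral_symm, show a + 2 * c = a + 2 * c * 1 by ring,
    show a - 2 * c = a + 2 * c * -1 by ring, ← hsub, ← intervalIntegral.integral_neg]
  have hpt : ∀ θ ∈ Set.uIcc 0 Real.pi,
      -(((fun t => semicirclePoly a (c ^ 2) t n *
        (Real.sqrt (4 * c ^ 2 - (t - a) ^ 2) / (2 * Real.pi * c ^ 2))) ∘
          fun θ => a + 2 * c * Real.cos θ) θ * (2 * c * -Real.sin θ)) =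
      (2 / Real.pi * c ^ n) * (Real.sin ((n + 1) * θ) * Real.sin θ) := by
    intro θ hθ
    rw [Set.uIcc_of_le Real.pi_pos.le] at hθ
    have hs : Real.sqrt (4 * c ^ 2 - (a + 2 * c * Real.cos θ - a) ^ 2) = 2 * c * Real.sin θ := by
      rw [show 4 * c ^ 2 - (a + 2 * c * Real.cos θ - a) ^ 2 = (2 * c * Real.sin θ) ^ 2 by
        rw [mul_pow, Real.sin_sq]; ring]
      exact Real.sqrt_sq (mul_nonneg (by positivity) (Real.sin_nonneg_of_mem_Icc hθ))
    have hπ := Real.pi_ne_zero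
    simp only [Function.comp_apply]
    rw [hs]
    have hp := semicirclePoly_cos_mul_sin a c θ n
    generalize semicirclePoly a (c ^ 2) (a + 2 * c * Real.cos θ) n = p at hp ⊢
    field_simp
    linear_combination Real.sin θ * hp
  rw [intervalIntegral.integral_congr hpt, intervalIntegral.integral_const_mul,
    integral_sin_mul_sin]
  split_ifs with h
  · have hπ := Real.pi_ne_zero
    subst h
    field_simp
  · simp

/-- The product over the blocks of `V` of `a` for singletons and `b` for other blocks. -/
noncomputable def blockWeight {α : Type*} (a b : ℝ) (V : Finset (Finset α)) : ℝ :=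
  ∏ B ∈ V, if B.card = 1 then a else b

theorem pow_card_eq_sum_partialMatchings {α : Type*} [LinearOrder α] (a b t : ℝ) (S : Finset α) :
    t ^ S.card = ∑ V ∈ partialMatchings S,
      blockWeight a b V * semicirclePoly a b t (freePoints S V).card := by
  classical
  induction S using Finset.induction_on_max with
  | empty => simp [partialMatchings_empty, blockWeight, freePoints, semicirclePoly]
  | insert x S hx ih =>
    have hxS : x ∉ S := fun h => (hx x h).false
    rw [Finset.card_insert_of_notMem hxS, pow_succ, ih, Finset.sum_mul,
      sum_partialMatchings_insert hx
        (fun V => if h : (freePoints S V).Nonempty then (freePoints S V).max' h else x)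
        (fun V h => by simpa [h] using Finset.isGreatest_max' _ h)]
    refine Finset.sum_congr rfl fun V hV => ?_
    rw [mem_partialMatchings] at hV
    have hx_notMem : ∀ B, x ∈ B → B ∉ V := fun B hxB hB => hxS (hV.subset B hB hxB)
    have hfree : x ∉ freePoints S V := fun h => hxS (mem_freePoints.1 h).1
    rw [freePoints_insert_right hV hxS, Finset.card_insert_of_notMem hfree,
      freePoints_insert_singleton hxS,
      show blockWeight a b (insert {x} V) = a * blockWeight a b V by
        simp [blockWeight, Finset.prod_insert (hx_notMem {x} (by simp))]]
    split_ifs with h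
    · have hm := Finset.max'_mem _ h
      set m := (freePoints S V).max' h
      have hmx : m ≠ x := fun e => hfree (e ▸ hm)
      rw [show blockWeight a b (insert {m, x} V) = b * blockWeight a b V by
        simp [blockWeight, Finset.prod_insert (hx_notMem {m, x} (by simp)),
          Finset.card_pair hmx], freePoints_insert_pair hxS, Finset.card_erase_of_mem hm]
      obtain ⟨k, hk⟩ := Nat.exists_eq_add_one.2 (Finset.card_pos.2 h)
      simp only [hk, add_tsub_cancel_right, semicirclePoly]
      ring
    · simp only [Finset.not_nonempty_iff_eq_empty.1 h, Finset.card_empty, zero_add,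
        semicirclePoly]
      ring

theorem blockWeight_eq {α : Type*} (a b : ℝ) (V : Finset (Finset α)) :
    blockWeight a b V = a ^ (V.filter fun B => B.card = 1).card *
      b ^ (V.card - (V.filter fun B => B.card = 1).card) := by
  rw [blockWeight, Finset.prod_ite, Finset.prod_const, Finset.prod_const,
    ← Finset.card_filter_add_card_filter_not (s := V) (fun B => B.card = 1), add_tsub_cancel_left]

theorem bijOn_parts (n : ℕ) :
    Set.BijOn Finpartition.parts
      {V : Finpartition (Finset.univ : Finset (Fin n)) |
        IsNoncrossing V ∧ ∀ B ∈ V.parts, B.card ≤ 2}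
      ((partialMatchings (Finset.univ : Finset (Fin n))).filter
        fun V => (freePoints Finset.univ V).card = 0 : Finset (Finset (Finset (Fin n)))) := by
  refine ⟨?_, fun V _ W _ h => Finpartition.ext h, ?_⟩
  · rintro V ⟨hnc, hcard⟩
    have hcov : ∀ j, ∃ B ∈ V.parts, j ∈ B := fun j => V.exists_mem (Finset.mem_univ j)
    simp only [Finset.coe_filter, Set.mem_ofPred_eq, mem_partialMatchings]
    refine ⟨⟨fun B _ => Finset.subset_univ B, fun B hB => V.nonempty_of_mem_parts hB, hcard,
      fun B hB B' hB' x hx hx' => V.eq_of_mem_parts hB hB' hx hx', ?_,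
      fun _ j _ _ _ _ _ _ _ _ => hcov j⟩, ?_⟩
    · intro i j k l hij hjk hkl B hB B' hB' hi hk hj hl
      by_contra hne
      exact hnc ⟨i, j, k, l, hij, hjk, hkl, B, hB, B', hB', hne, hi, hk, hj, hl⟩
    · rw [Finset.card_eq_zero, Finset.eq_empty_iff_forall_notMem]
      intro j hj
      obtain ⟨B, hB, hjB⟩ := hcov j
      exact (mem_freePoints.1 hj).2 B hB hjB
  · intro V hV
    simp only [Finset.coe_filter, Set.mem_ofPred_eq, mem_partialMatchings] at hV
    obtain ⟨hV, hfree⟩ := hV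
    refine ⟨Finpartition.ofExistsUnique V hV.subset ?_ ?_, ⟨?_, hV.card_le⟩, rfl⟩
    · intro j _
      have hj : j ∉ freePoints Finset.univ V := by simp [Finset.card_eq_zero.1 hfree]
      obtain ⟨B, hB, hjB⟩ : ∃ B ∈ V, j ∈ B := by
        simpa [mem_freePoints] using hj
      exact ⟨B, ⟨hB, hjB⟩, fun C hC => hV.eq_of_mem C hC.1 B hB j hC.2 hjB⟩
    · exact fun h => Finset.not_nonempty_empty (hV.nonempty _ h)
    · rintro ⟨i, j, k, l, hij, hjk, hkl, B, hB, B', hB', hne, hi, hk, hj, hl⟩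
      exact hne (hV.noncrossing i j k l hij hjk hkl B hB B' hB' hi hk hj hl)

/-- **Moments of the semicircle law.** For the semicircle density `w_{a,b}` of mean
`a` and variance `b`, the `n`-th moment equals
`∑_{V ∈ NC_{≤2}(n)} a^{s(V)} b^{|V| - s(V)}`, the sum over noncrossing partitions
of `{1, …, n}` with blocks of size at most 2, where `s(V)` is the number of
singleton blocks of `V` and `|V|` the number of blocks of `V`. -/
theorem stmt_11 (a b : ℝ) (hb : 0 < b)
    (w : ℝ → ℝ)
    (hw : ∀ x, w x =
      if x ∈ Set.Icc (a - 2 * Real.sqrt b) (a + 2 * Real.sqrt b) then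
        Real.sqrt (4 * b - (x - a) ^ 2) / (2 * Real.pi * b)
      else 0)
    (n : ℕ) :
    ∫ x : ℝ, x ^ n * w x =
      ∑ᶠ V ∈ {V : Finpartition (Finset.univ : Finset (Fin n)) |
          IsNoncrossing V ∧ ∀ B ∈ V.parts, B.card ≤ 2},
        a ^ singletonCount V * b ^ (V.parts.card - singletonCount V) := by
  rw [finsum_mem_eq_of_bijOn
    (f := fun V : Finpartition (Finset.univ : Finset (Fin n)) =>
      a ^ singletonCount V * b ^ (V.parts.card - singletonCount V))
    Finpartition.parts (bijOn_parts n) (g := fun V => blockWeight a b V)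
    fun V _ => (blockWeight_eq a b V.parts).symm,
    finsum_mem_coe_finset]
  obtain ⟨c, hc, rfl⟩ : ∃ c : ℝ, 0 < c ∧ b = c ^ 2 :=
    ⟨Real.sqrt b, Real.sqrt_pos.2 hb, (Real.sq_sqrt hb.le).symm⟩
  rw [Real.sqrt_sq hc.le] at hw
  have hind : (fun x => x ^ n * w x) = (Set.Icc (a - 2 * c) (a + 2 * c)).indicator fun x =>
      x ^ n * (Real.sqrt (4 * c ^ 2 - (x - a) ^ 2) / (2 * Real.pi * c ^ 2)) := by
    ext x
    rw [hw, Set.indicator_apply]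
    split_ifs
    · rfl
    · exact mul_zero _
  rw [hind, integral_indicator measurableSet_Icc, integral_Icc_eq_integral_Ioc,
    ← intervalIntegral.integral_of_le (by linarith)]
  have hpow : ∀ x : ℝ, x ^ n = ∑ V ∈ partialMatchings (Finset.univ : Finset (Fin n)),
      blockWeight a (c ^ 2) V *
        semicirclePoly a (c ^ 2) x (freePoints Finset.univ V).card := fun x => by
    rw [← pow_card_eq_sum_partialMatchings, Finset.card_univ, Fintype.card_fin]
  simp_rw [hpow, Finset.sum_mul, mul_assoc (blockWeight _ _ _)]
  rw [intervalIntegral.integral_finsetSum]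
  · simp_rw [intervalIntegral.integral_const_mul, integral_semicirclePoly hc, mul_ite, mul_one,
      mul_zero, Finset.sum_filter]
  · intro V _
    exact (((continuous_semicirclePoly a (c ^ 2) _).mul (by fun_prop)).const_smul
      (blockWeight a (c ^ 2) V)).intervalIntegrable _ _
end

section
/- Let a ∈ ℝ and b > 0 with a² ≤ 4b, and let f_{a,b} be the free Meixner density. Define c : ℕ → ℝ by c(1) = 0 and, for k ≥ 0, c(k+2) = Σ_{W ∈ NC_{≤2}(k)} a^{s(W)}·b^{|W| − s(W)}. Then for every natural number n ≥ 1, the n-th moment of the free Meixner law satisfies ∫_ℝ xⁿ·f_{a,b}(x) dx = Σ_{V ∈ NC(n)} Π_{B ∈ V} c(|B|), the sum over all noncrossing partitions V of {1,…,n} of the product over the blocks B of V of c evaluated at the block size |B|. -/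
open MeasureTheory

/-- `P` is the set of blocks of a noncrossing partition of `{p, …, q - 1}`. -/
structure IsNCPartition (p q : ℕ) (P : Finset (Finset ℕ)) : Prop where
  nonempty : ∀ B ∈ P, ∃ x, x ∈ B
  mem_Ico : ∀ B ∈ P, ∀ x ∈ B, p ≤ x ∧ x < q
  cover : ∀ x, p ≤ x → x < q → ∃ B ∈ P, x ∈ B
  unique : ∀ B ∈ P, ∀ B' ∈ P, ∀ x, x ∈ B → x ∈ B' → B = B'
  noncrossing : ∀ B ∈ P, ∀ B' ∈ P, ∀ i₁ j₁ i₂ j₂, i₁ < j₁ → j₁ < i₂ → i₂ < j₂ →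
    i₁ ∈ B → i₂ ∈ B → j₁ ∈ B' → j₂ ∈ B' → B = B'

open Classical in
/-- The noncrossing partitions of `{p, …, q - 1}`, as a finset. -/
noncomputable def ncPartitions (p q : ℕ) : Finset (Finset (Finset ℕ)) :=
  (Finset.Ico p q).powerset.powerset.filter (IsNCPartition p q)

theorem mem_ncPartitions {p q : ℕ} {P : Finset (Finset ℕ)} :
    P ∈ ncPartitions p q ↔ IsNCPartition p q P := by
  classical
  simp only [ncPartitions, Finset.mem_filter, Finset.mem_powerset, and_iff_right_iff_imp]
  intro h B hB
  simp only [Finset.mem_powerset]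
  intro x hx
  simpa using h.mem_Ico B hB x hx

/-- Join a partition of `{p + 1, …, j - 1}` with one of `{j, …, q - 1}`, adding `p` to the block
of `j`. -/
def glue (p j : ℕ) (P : Finset (Finset ℕ) × Finset (Finset ℕ)) : Finset (Finset ℕ) :=
  P.1 ∪ P.2.image fun B => if j ∈ B then insert p B else B

/-- The blocks meeting `{p + 1, …, j - 1}`, and the traces on `{j, …}` of the others. -/
def unglue (p j : ℕ) (P : Finset (Finset ℕ)) : Finset (Finset ℕ) × Finset (Finset ℕ) :=
  (P.filter fun B => ∃ x ∈ B, p < x ∧ x < j, (P.filter fun B => ∃ x ∈ B, j ≤ x).image (·.erase p))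

theorem mem_glue {p j : ℕ} {P : Finset (Finset ℕ) × Finset (Finset ℕ)} {B : Finset ℕ} :
    B ∈ glue p j P ↔ B ∈ P.1 ∨ ∃ C ∈ P.2, (if j ∈ C then insert p C else C) = B := by
  simp [glue]

/-- `j` is the successor of `p` in its block. -/
def IsNext (p j : ℕ) (P : Finset (Finset ℕ)) : Prop :=
  ∃ B ∈ P, p ∈ B ∧ j ∈ B ∧ ∀ x ∈ B, p < x → j ≤ x

theorem IsNCPartition.insert_singleton {p q : ℕ} (hpq : p < q) {P : Finset (Finset ℕ)}
    (h : IsNCPartition (p + 1) q P) : IsNCPartition p q (insert {p} P) := by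
  have hlt : ∀ B ∈ P, ∀ x ∈ B, x ≠ p := fun B hB x hx => by have := h.mem_Ico B hB x hx; omega
  refine ⟨?_, ?_, ?_, ?_, ?_⟩
  · intro B hB
    rcases Finset.mem_insert.1 hB with rfl | hB
    · exact ⟨p, by simp⟩
    · exact h.nonempty B hB
  · intro B hB x hx
    rcases Finset.mem_insert.1 hB with rfl | hB
    · have := Finset.mem_singleton.1 hx; omega
    · have := h.mem_Ico B hB x hx; omega
  · intro x hx hxq
    by_cases hxp : x = p
    · exact ⟨{p}, by simp, by simp [hxp]⟩
    · obtain ⟨B, hB, hxB⟩ := h.cover x (by omega) hxq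
      exact ⟨B, by simp [hB], hxB⟩
  · intro B hB B' hB' x hx hx'
    rcases Finset.mem_insert.1 hB with rfl | hB <;> rcases Finset.mem_insert.1 hB' with rfl | hB'
    · rfl
    · exact absurd (Finset.mem_singleton.1 hx) (hlt B' hB' x hx')
    · exact absurd (Finset.mem_singleton.1 hx') (hlt B hB x hx)
    · exact h.unique B hB B' hB' x hx hx'
  · intro B hB B' hB' i₁ j₁ i₂ j₂ a1 a2 a3 b1 b2 b3 b4
    rcases Finset.mem_insert.1 hB with rfl | hB <;> rcases Finset.mem_insert.1 hB' with rfl | hB'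
    · rfl
    · simp only [Finset.mem_singleton] at b1 b2; omega
    · simp only [Finset.mem_singleton] at b3 b4; omega
    · exact h.noncrossing B hB B' hB' i₁ j₁ i₂ j₂ a1 a2 a3 b1 b2 b3 b4

theorem IsNCPartition.erase_singleton {p q : ℕ} {P : Finset (Finset ℕ)}
    (h : IsNCPartition p q P) (hp : {p} ∈ P) :
    IsNCPartition (p + 1) q (P.erase {p}) := by
  obtain ⟨h1, h2, h3, h4, h5⟩ := h
  refine ⟨?_, ?_, ?_, ?_, ?_⟩
  · grind
  · intro B hB x hx
    have := h2 B (by grind) x hx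
    have := h4 {p} hp B (by grind) x
    grind
  · intro x hx hxq
    obtain ⟨B, hB, hxB⟩ := h3 x (by omega) hxq
    exact ⟨B, by grind, hxB⟩
  · grind
  · intro B hB B' hB' i₁ j₁ i₂ j₂ a1 a2 a3 b1 b2 b3 b4
    exact h5 B (by grind) B' (by grind) i₁ j₁ i₂ j₂ a1 a2 a3 b1 b2 b3 b4

theorem mem_ite_insert {p j x : ℕ} {C : Finset ℕ} :
    x ∈ (if j ∈ C then insert p C else C) ↔ x ∈ C ∨ (x = p ∧ j ∈ C) := by
  split_ifs with h
  · simp [h, or_comm]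
  · simp [h]

theorem IsNCPartition.glue {p j q : ℕ} (hpj : p < j) (hjq : j < q)
    {P : Finset (Finset ℕ) × Finset (Finset ℕ)}
    (h : IsNCPartition (p + 1) j P.1) (h' : IsNCPartition j q P.2) :
    IsNCPartition p q (glue p j P) := by
  obtain ⟨P, Q⟩ := P
  obtain ⟨h1, h2, h3, h4, h5⟩ := h
  obtain ⟨k1, k2, k3, k4, k5⟩ := h'
  simp only at *
  refine ⟨?_, ?_, ?_, ?_, ?_⟩
  · intro B hB
    rcases mem_glue.1 hB with hB | ⟨C, hC, rfl⟩
    · exact h1 B hB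
    · obtain ⟨x, hx⟩ := k1 C hC
      exact ⟨x, mem_ite_insert.2 (Or.inl hx)⟩
  · intro B hB x hx
    rcases mem_glue.1 hB with hB | ⟨C, hC, rfl⟩
    · have := h2 B hB x hx; omega
    · rcases mem_ite_insert.1 hx with hx | ⟨rfl, -⟩
      · have := k2 C hC x hx; omega
      · omega
  · intro x hx hxq
    simp only [mem_glue]
    by_cases hxp : x = p
    · obtain ⟨B, hB, hxB⟩ := k3 j le_rfl hjq
      exact ⟨_, Or.inr ⟨B, hB, rfl⟩, mem_ite_insert.2 (Or.inr ⟨hxp, hxB⟩)⟩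
    · by_cases hxj : x < j
      · obtain ⟨B, hB, hxB⟩ := h3 x (by omega) hxj
        exact ⟨_, Or.inl hB, hxB⟩
      · obtain ⟨B, hB, hxB⟩ := k3 x (by omega) hxq
        exact ⟨_, Or.inr ⟨B, hB, rfl⟩, mem_ite_insert.2 (Or.inl hxB)⟩
  · intro B hB B' hB' x hx hx'
    rcases mem_glue.1 hB with hB | ⟨C, hC, rfl⟩ <;> rcases mem_glue.1 hB' with hB' | ⟨C', hC', rfl⟩
    · exact h4 B hB B' hB' x hx hx'
    · have := h2 B hB x hx
      rcases mem_ite_insert.1 hx' with hx' | ⟨rfl, -⟩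
      · have := k2 C' hC' x hx'; omega
      · omega
    · have := h2 B' hB' x hx'
      rcases mem_ite_insert.1 hx with hx | ⟨rfl, -⟩
      · have := k2 C hC x hx; omega
      · omega
    · have : C = C' := by
        rcases mem_ite_insert.1 hx with hx | ⟨rfl, hjC⟩ <;>
          rcases mem_ite_insert.1 hx' with hx' | ⟨hp, hjC'⟩
        · exact k4 C hC C' hC' x hx hx'
        · have := k2 C hC x hx; omega
        · have := k2 C' hC' x hx'; omega
        · exact k4 C hC C' hC' j hjC hjC'
      rw [this]
  · intro B hB B' hB' i₁ j₁ i₂ j₂ a1 a2 a3 b1 b2 b3 b4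
    rcases mem_glue.1 hB with hB | ⟨C, hC, rfl⟩ <;> rcases mem_glue.1 hB' with hB' | ⟨C', hC', rfl⟩
    · exact h5 B hB B' hB' i₁ j₁ i₂ j₂ a1 a2 a3 b1 b2 b3 b4
    · have := h2 B hB i₁ b1
      have := h2 B hB i₂ b2
      rcases mem_ite_insert.1 b3 with b3 | ⟨rfl, -⟩
      · have := k2 C' hC' j₁ b3; omega
      · omega
    · have := h2 B' hB' j₁ b3
      have := h2 B' hB' j₂ b4
      rcases mem_ite_insert.1 b2 with b2 | ⟨rfl, -⟩
      · have := k2 C hC i₂ b2; omega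
      · omega
    · have hge : ∀ C ∈ Q, ∀ x y, x ∈ (if j ∈ C then insert p C else C) →
          (y < x ∧ (y = p ∨ j ≤ y)) → x ∈ C := by
        intro C hC x y hx hy
        rcases mem_ite_insert.1 hx with hx | ⟨rfl, -⟩
        · exact hx
        · omega
      have hi1 : i₁ = p ∨ j ≤ i₁ := by
        rcases mem_ite_insert.1 b1 with b1 | ⟨rfl, -⟩
        · exact Or.inr (k2 C hC _ b1).1
        · exact Or.inl rfl
      have hj1 : j₁ ∈ C' := hge C' hC' j₁ i₁ b3 ⟨a1, hi1⟩
      have hj1' := k2 C' hC' _ hj1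
      have hi2 : i₂ ∈ C := hge C hC i₂ j₁ b2 ⟨a2, Or.inr hj1'.1⟩
      have hi2' := k2 C hC _ hi2
      have hj2 : j₂ ∈ C' := hge C' hC' j₂ i₂ b4 ⟨a3, Or.inr hi2'.1⟩
      have : C = C' := by
        rcases mem_ite_insert.1 b1 with b1 | ⟨rfl, hjC⟩
        · exact k5 C hC C' hC' i₁ j₁ i₂ j₂ a1 a2 a3 b1 hi2 hj1 hj2
        · by_cases hj : j = j₁
          · exact k4 C hC C' hC' j hjC (hj ▸ hj1)
          · exact k5 C hC C' hC' j j₁ i₂ j₂ (by omega) a2 a3 hjC hi2 hj1 hj2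
      rw [this]

theorem IsNCPartition.isNext_glue {p j q : ℕ} (hjq : j < q)
    {P : Finset (Finset ℕ) × Finset (Finset ℕ)}
    (h' : IsNCPartition j q P.2) : IsNext p j (_root_.glue p j P) := by
  obtain ⟨B, hB, hxB⟩ := h'.cover j le_rfl hjq
  refine ⟨insert p B, mem_glue.2 (Or.inr ⟨B, hB, by simp [hxB]⟩), by simp, by simp [hxB], ?_⟩
  intro x hx hpx
  have := h'.mem_Ico B hB x
  grind

/-- In a noncrossing partition, a block meeting the gap between `p` and its successor stays
in it. -/
theorem IsNCPartition.mem_gap {p j q : ℕ} {P : Finset (Finset ℕ)} (h : IsNCPartition p q P)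
    (hn : IsNext p j P) {B : Finset ℕ} (hB : B ∈ P) {x y : ℕ} (hx : x ∈ B) (hy : y ∈ B)
    (hpx : p < x) (hxj : x < j) : p < y ∧ y < j := by
  obtain ⟨C, hC, hpC, hjC, hmin⟩ := hn
  have hBC : B ≠ C := by grind
  have hyp : p ≤ y := (h.mem_Ico B hB y hy).1
  have hyC : y ∉ C := fun hyC => hBC (h.unique B hB C hC y hy hyC)
  have : ¬ j < y := fun hjy => hBC (h.noncrossing C hC B hB p x j y hpx hxj hjy hpC hjC hx hy).symm
  grind

theorem IsNCPartition.unglue_fst {p j q : ℕ} (hjq : j < q) {P : Finset (Finset ℕ)}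
    (h : IsNCPartition p q P) (hn : IsNext p j P) : IsNCPartition (p + 1) j (unglue p j P).1 := by
  have hgap := @h.mem_gap p j q P hn
  have hmem : ∀ B, B ∈ (unglue p j P).1 ↔ B ∈ P ∧ ∃ x ∈ B, p < x ∧ x < j := by
    simp [unglue]
  refine ⟨?_, ?_, ?_, ?_, ?_⟩
  · intro B hB
    exact h.nonempty B ((hmem B).1 hB).1
  · intro B hB x hx
    obtain ⟨hB, y, hy, hpy, hyj⟩ := (hmem B).1 hB
    exact hgap hB hy hx hpy hyj
  · intro x hx hxq
    obtain ⟨B, hB, hxB⟩ := h.cover x (by omega) (by omega)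
    exact ⟨B, (hmem B).2 ⟨hB, x, hxB, hx, hxq⟩, hxB⟩
  · intro B hB B' hB'
    exact h.unique B ((hmem B).1 hB).1 B' ((hmem B').1 hB').1
  · intro B hB B' hB'
    exact h.noncrossing B ((hmem B).1 hB).1 B' ((hmem B').1 hB').1

theorem IsNCPartition.unglue_snd {p j q : ℕ} (hpj : p < j) {P : Finset (Finset ℕ)}
    (h : IsNCPartition p q P) (hn : IsNext p j P) : IsNCPartition j q (unglue p j P).2 := by
  have hgap := @h.mem_gap p j q P hn
  have hmem : ∀ B, B ∈ (unglue p j P).2 ↔ ∃ C ∈ P, (∃ x ∈ C, j ≤ x) ∧ C.erase p = B := by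
    simp [unglue, and_assoc]
  refine ⟨?_, ?_, ?_, ?_, ?_⟩
  · intro B hB
    obtain ⟨C, hC, ⟨y, hy, hyj⟩, rfl⟩ := (hmem B).1 hB
    exact ⟨y, by simp only [Finset.mem_erase]; exact ⟨by omega, hy⟩⟩
  · intro B hB x hx
    obtain ⟨C, hC, ⟨y, hy, hyj⟩, rfl⟩ := (hmem B).1 hB
    obtain ⟨hxp, hx⟩ := Finset.mem_erase.1 hx
    have := h.mem_Ico C hC x hx
    refine ⟨?_, this.2⟩
    by_contra hxj
    have := hgap hC hx hy (by omega) (by omega)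
    omega
  · intro x hx hxq
    obtain ⟨B, hB, hxB⟩ := h.cover x (by omega) (by omega)
    exact ⟨B.erase p, (hmem _).2 ⟨B, hB, ⟨x, hxB, hx⟩, rfl⟩,
      by simp only [Finset.mem_erase]; exact ⟨by omega, hxB⟩⟩
  · intro B hB B' hB' x hx hx'
    obtain ⟨C, hC, -, rfl⟩ := (hmem B).1 hB
    obtain ⟨C', hC', -, rfl⟩ := (hmem B').1 hB'
    rw [h.unique C hC C' hC' x (Finset.mem_of_mem_erase hx) (Finset.mem_of_mem_erase hx')]
  · intro B hB B' hB' i₁ j₁ i₂ j₂ a1 a2 a3 b1 b2 b3 b4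
    obtain ⟨C, hC, -, rfl⟩ := (hmem B).1 hB
    obtain ⟨C', hC', -, rfl⟩ := (hmem B').1 hB'
    rw [h.noncrossing C hC C' hC' i₁ j₁ i₂ j₂ a1 a2 a3 (Finset.mem_of_mem_erase b1)
      (Finset.mem_of_mem_erase b2) (Finset.mem_of_mem_erase b3) (Finset.mem_of_mem_erase b4)]

theorem unglue_glue {p j q : ℕ} (hpj : p < j)
    {P : Finset (Finset ℕ) × Finset (Finset ℕ)}
    (h : IsNCPartition (p + 1) j P.1) (h' : IsNCPartition j q P.2) :
    unglue p j (glue p j P) = P := by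
  obtain ⟨P, Q⟩ := P
  have h1 := h.nonempty
  have h2 := h.mem_Ico
  have k1 := h'.nonempty
  have k2 := h'.mem_Ico
  simp only [unglue, Prod.mk.injEq] at *
  constructor
  · ext B
    simp only [Finset.mem_filter, mem_glue]
    constructor
    · rintro ⟨hB | ⟨C, hC, rfl⟩, x, hx, hpx, hxj⟩
      · exact hB
      · grind
    · intro hB
      obtain ⟨x, hx⟩ := h1 B hB
      exact ⟨Or.inl hB, x, hx, by grind⟩
  · ext B
    simp only [Finset.mem_image, Finset.mem_filter, mem_glue]
    constructor
    · rintro ⟨_, ⟨hB | ⟨C, hC, rfl⟩, x, hx, hxj⟩, rfl⟩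
      · grind
      · have : (if j ∈ C then insert p C else C).erase p = C := by
          have : p ∉ C := fun hp => by have := k2 C hC p hp; omega
          split_ifs <;> simp [this]
        rwa [this]
    · intro hB
      have : p ∉ B := fun hp => by have := k2 B hB p hp; omega
      obtain ⟨x, hx⟩ := k1 B hB
      refine ⟨_, ⟨Or.inr ⟨B, hB, rfl⟩, x, ?_, (k2 B hB x hx).1⟩, ?_⟩
      · split_ifs <;> simp [hx]
      · split_ifs <;> simp [this]

theorem glue_unglue {p j q : ℕ} (hpj : p < j) {P : Finset (Finset ℕ)}
    (h : IsNCPartition p q P) (hn : IsNext p j P) : glue p j (unglue p j P) = P := by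
  have hgap := @h.mem_gap p j q P hn
  obtain ⟨C, hC, hpC, hjC, hmin⟩ := hn
  have key : ∀ B ∈ P, (∃ x ∈ B, j ≤ x) →
      (if j ∈ B.erase p then insert p (B.erase p) else B.erase p) = B := by
    intro B hB hx
    by_cases hjB : j ∈ B
    · have : B = C := h.unique B hB C hC j hjB hjC
      subst this
      simp [hpj.ne', hjB, hpC]
    · have : p ∉ B := fun hpB => hjB (h.unique B hB C hC p hpB hpC ▸ hjC)
      simp [this, hjB]
  ext B
  simp only [mem_glue, unglue, Finset.mem_filter, Finset.mem_image]
  constructor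
  · rintro (hB | ⟨_, ⟨B', hB', rfl⟩, rfl⟩)
    · exact hB.1
    · rw [key B' hB'.1 hB'.2]
      exact hB'.1
  · intro hB
    by_cases hx : ∃ x ∈ B, j ≤ x
    · exact Or.inr ⟨_, ⟨B, ⟨hB, hx⟩, rfl⟩, key B hB hx⟩
    · refine Or.inl ⟨hB, ?_⟩
      obtain ⟨x, hxB⟩ := h.nonempty B hB
      refine ⟨x, hxB, ?_, by grind⟩
      have := h.mem_Ico B hB x hxB
      have : x ≠ p := by
        rintro rfl
        have := h.unique B hB C hC x hxB hpC
        grind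
      omega

/-- The sum over noncrossing partitions of `{p, …, q - 1}` of the product of block weights, where
the block of `p` is weighted by `v` and the others by `w`. -/
noncomputable def ncSum (w v : ℕ → ℝ) (p q : ℕ) : ℝ :=
  ∑ P ∈ ncPartitions p q, ∏ B ∈ P, if p ∈ B then v B.card else w B.card

theorem ncSum_self (w v : ℕ → ℝ) (p : ℕ) : ncSum w v p p = 1 := by
  have : ncPartitions p p = {∅} := by
    ext P
    rw [mem_ncPartitions, Finset.mem_singleton]
    constructor
    · intro h
      refine Finset.eq_empty_of_forall_notMem fun B hB => ?_
      obtain ⟨x, hx⟩ := h.nonempty B hB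
      have := h.mem_Ico B hB x hx
      omega
    · rintro rfl
      refine ⟨by simp, by simp, fun x _ _ => by omega, by simp, by simp⟩
  simp [ncSum, this]

theorem prod_ite_mem_of_lt {p p' q : ℕ} (w v : ℕ → ℝ) (hp : p < p') {P : Finset (Finset ℕ)}
    (h : IsNCPartition p' q P) :
    ∏ B ∈ P, (if p ∈ B then v B.card else w B.card) = ∏ B ∈ P, w B.card := by
  refine Finset.prod_congr rfl fun B hB => if_neg fun hpB => ?_
  have := h.mem_Ico B hB p hpB
  omega

theorem ncSum_same (w : ℕ → ℝ) (p q : ℕ) :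
    ncSum w w p q = ∑ P ∈ ncPartitions p q, ∏ B ∈ P, w B.card := by
  simp [ncSum]

theorem sum_filter_singleton_mem (w v : ℕ → ℝ) {p q : ℕ} (hpq : p < q) :
    ∑ P ∈ ncPartitions p q with {p} ∈ P, ∏ B ∈ P, (if p ∈ B then v B.card else w B.card) =
      v 1 * ncSum w w (p + 1) q := by
  have hnot : ∀ P ∈ ncPartitions (p + 1) q, {p} ∉ P := fun P hP hp => by
    have := (mem_ncPartitions.1 hP).mem_Ico {p} hp p (by simp)
    omega
  rw [ncSum_same, Finset.mul_sum]
  symm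
  refine Finset.sum_nbij' (insert {p}) (·.erase {p}) ?_ ?_ ?_ ?_ ?_
  · intro P hP
    simp only [Finset.mem_filter, mem_ncPartitions] at hP ⊢
    exact ⟨hP.insert_singleton hpq, by simp⟩
  · intro P hP
    simp only [Finset.mem_filter, mem_ncPartitions] at hP ⊢
    exact hP.1.erase_singleton hP.2
  · intro P hP
    exact Finset.erase_insert (hnot P hP)
  · intro P hP
    exact Finset.insert_erase (Finset.mem_filter.1 hP).2
  · intro P hP
    rw [Finset.prod_insert (hnot P hP),
      prod_ite_mem_of_lt w v (Nat.lt_succ_self p) (mem_ncPartitions.1 hP)]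
    simp

theorem prod_glue (w v : ℕ → ℝ) {p j q : ℕ} (hpj : p < j)
    {P : Finset (Finset ℕ) × Finset (Finset ℕ)}
    (h : IsNCPartition (p + 1) j P.1) (h' : IsNCPartition j q P.2) :
    ∏ B ∈ glue p j P, (if p ∈ B then v B.card else w B.card) =
      (∏ B ∈ P.1, w B.card) * ∏ B ∈ P.2, if j ∈ B then v (B.card + 1) else w B.card := by
  have hp : ∀ B ∈ P.2, p ∉ B := fun B hB hpB => by
    have := h'.mem_Ico B hB p hpB
    omega
  have herase : ∀ B ∈ P.2, (if j ∈ B then insert p B else B).erase p = B := fun B hB => by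
    split_ifs <;> simp [hp B hB]
  rw [glue, Finset.prod_union, Finset.prod_image]
  · congr 1
    · exact prod_ite_mem_of_lt w v (Nat.lt_succ_self p) h
    · refine Finset.prod_congr rfl fun B hB => ?_
      by_cases hj : j ∈ B <;> simp [hj, hp B hB]
  · intro B hB B' hB' hBB'
    rw [← herase B hB, ← herase B' hB']
    exact congrArg (·.erase p) hBB'
  · rw [Finset.disjoint_left]
    intro B hB hB'
    obtain ⟨C, hC, rfl⟩ := Finset.mem_image.1 hB'
    obtain ⟨x, hx⟩ := h'.nonempty C hC
    have := h'.mem_Ico C hC x hx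
    have := h.mem_Ico _ hB x (mem_ite_insert.2 (Or.inl hx))
    omega

open Classical in
theorem sum_filter_isNext (w v : ℕ → ℝ) {p j q : ℕ} (hpj : p < j) (hjq : j < q) :
    ∑ P ∈ ncPartitions p q with IsNext p j P,
        ∏ B ∈ P, (if p ∈ B then v B.card else w B.card) =
      ncSum w w (p + 1) j * ncSum w (fun k => v (k + 1)) j q := by
  rw [ncSum_same, ncSum, Finset.sum_mul_sum, ← Finset.sum_product']
  symm
  refine Finset.sum_nbij' (glue p j) (unglue p j) ?_ ?_ ?_ ?_ ?_
  · intro P hP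
    simp only [Finset.mem_filter, mem_ncPartitions, Finset.mem_product] at hP ⊢
    exact ⟨hP.1.glue hpj hjq hP.2, hP.2.isNext_glue hjq⟩
  · intro P hP
    simp only [Finset.mem_filter, mem_ncPartitions, Finset.mem_product] at hP ⊢
    exact ⟨hP.1.unglue_fst hjq hP.2, hP.1.unglue_snd hpj hP.2⟩
  · intro P hP
    simp only [mem_ncPartitions, Finset.mem_product] at hP
    exact unglue_glue hpj hP.1 hP.2
  · intro P hP
    simp only [Finset.mem_filter, mem_ncPartitions] at hP
    exact glue_unglue hpj hP.1 hP.2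
  · intro P hP
    simp only [mem_ncPartitions, Finset.mem_product] at hP
    rw [prod_glue w v hpj hP.1 hP.2]

theorem IsNext.unique {p q j j' : ℕ} {P : Finset (Finset ℕ)} (h : IsNCPartition p q P)
    (hpj : p < j) (hpj' : p < j') (hj : IsNext p j P) (hj' : IsNext p j' P) : j = j' := by
  obtain ⟨B, hB, hpB, hjB, hm⟩ := hj
  obtain ⟨B', hB', hpB', hjB', hm'⟩ := hj'
  obtain rfl := h.unique B hB B' hB' p hpB hpB'
  exact le_antisymm (hm j' hjB' hpj') (hm' j hjB hpj)

theorem IsNCPartition.singleton_notMem_iff {p q : ℕ} {P : Finset (Finset ℕ)} (hpq : p < q)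
    (h : IsNCPartition p q P) : {p} ∉ P ↔ ∃ j, p < j ∧ j < q ∧ IsNext p j P := by
  obtain ⟨B, hB, hpB⟩ := h.cover p le_rfl hpq
  constructor
  · intro hp
    have hne : (B.erase p).Nonempty := by
      rw [Finset.nonempty_iff_ne_empty]
      intro he
      rcases (Finset.erase_eq_empty_iff _ _).1 he with rfl | rfl
      · simp at hpB
      · exact hp hB
    obtain ⟨hjp, hjB⟩ := Finset.mem_erase.1 ((B.erase p).min'_mem hne)
    have hj := h.mem_Ico B hB _ hjB
    refine ⟨_, by omega, hj.2, B, hB, hpB, hjB, fun x hx hpx => ?_⟩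
    exact (B.erase p).min'_le x (Finset.mem_erase.2 ⟨by omega, hx⟩)
  · rintro ⟨j, hpj, -, C, hC, hpC, hjC, -⟩ hp
    obtain rfl := h.unique {p} hp C hC p (by simp) hpC
    have := Finset.mem_singleton.1 hjC
    omega

theorem ncSum_eq_add_sum (w v : ℕ → ℝ) {p q : ℕ} (hpq : p < q) :
    ncSum w v p q = v 1 * ncSum w w (p + 1) q +
      ∑ j ∈ Finset.Ioo p q, ncSum w w (p + 1) j * ncSum w (fun k => v (k + 1)) j q := by
  classical
  have hunion : (ncPartitions p q).filter (fun P => ¬ {p} ∈ P) =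
      (Finset.Ioo p q).biUnion fun j => (ncPartitions p q).filter (IsNext p j) := by
    ext P
    simp only [Finset.mem_filter, Finset.mem_biUnion, Finset.mem_Ioo]
    constructor
    · rintro ⟨hP, hp⟩
      obtain ⟨j, hj⟩ := ((mem_ncPartitions.1 hP).singleton_notMem_iff hpq).1 hp
      exact ⟨j, ⟨hj.1, hj.2.1⟩, hP, hj.2.2⟩
    · rintro ⟨j, hj, hP, hn⟩
      exact ⟨hP, ((mem_ncPartitions.1 hP).singleton_notMem_iff hpq).2 ⟨j, hj.1, hj.2, hn⟩⟩
  rw [ncSum, ← Finset.sum_filter_add_sum_filter_not _ (fun P => {p} ∈ P),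
    sum_filter_singleton_mem w v hpq, hunion, Finset.sum_biUnion]
  · congr 1
    refine Finset.sum_congr rfl fun j hj => ?_
    rw [Finset.mem_Ioo] at hj
    exact sum_filter_isNext w v hj.1 hj.2
  · intro j hj j' hj' hjj'
    rw [Function.onFun, Finset.disjoint_left]
    intro P hP hP'
    simp only [Finset.coe_Ioo, Set.mem_Ioo, Finset.mem_filter, mem_ncPartitions] at *
    exact hjj' (IsNext.unique hP.1 hj.1 hj'.1 hP.2 hP'.2)

theorem ncSum_add (w : ℕ → ℝ) (n : ℕ) : ∀ (v : ℕ → ℝ) (p : ℕ),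
    ncSum w v p (p + n) = ncSum w v 0 n := by
  induction n using Nat.strong_induction_on with
  | _ n ih =>
    have key : ∀ (v : ℕ → ℝ) (p q k : ℕ), k < n → p + k = q → ncSum w v p q = ncSum w v 0 k := by
      rintro v p _ k hk rfl
      exact ih k hk v p
    intro v p
    rcases Nat.eq_zero_or_pos n with rfl | hn
    · simp [ncSum_self]
    · have hsum : ∀ p : ℕ, ncSum w v p (p + n) = v 1 * ncSum w w 0 (n - 1) +
          ∑ i ∈ Finset.range (n - 1), ncSum w w 0 i * ncSum w (fun k => v (k + 1)) 0 (n - 1 - i) := by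
        intro p
        rw [ncSum_eq_add_sum w v (by omega), key w (p + 1) (p + n) (n - 1) (by omega) (by omega)]
        congr 1
        have : Finset.Ioo p (p + n) = (Finset.range (n - 1)).image (· + (p + 1)) := by
          ext j
          simp only [Finset.mem_Ioo, Finset.mem_image, Finset.mem_range]
          exact ⟨fun h => ⟨j - (p + 1), by omega, by omega⟩, by rintro ⟨i, hi, rfl⟩; omega⟩
        rw [this, Finset.sum_image (by intro x _ y _ h; simpa using h)]
        refine Finset.sum_congr rfl fun i hi => ?_
        rw [Finset.mem_range] at hi
        rw [key w (p + 1) _ i (by omega) (by omega), key _ _ (p + n) (n - 1 - i) (by omega) (by omega)]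
      rw [hsum p, ← hsum 0, zero_add]

theorem ncSum_succ (w v : ℕ → ℝ) (n : ℕ) :
    ncSum w v 0 (n + 1) = v 1 * ncSum w w 0 n +
      ∑ i ∈ Finset.range n, ncSum w w 0 i * ncSum w (fun k => v (k + 1)) 0 (n - i) := by
  rw [ncSum_eq_add_sum w v (by omega), add_comm n 1, ncSum_add]
  congr 1
  have : Finset.Ioo 0 (1 + n) = (Finset.range n).image (1 + ·) := by
    ext j
    simp only [Finset.mem_Ioo, Finset.mem_image, Finset.mem_range]
    exact ⟨fun h => ⟨j - 1, by omega, by omega⟩, by rintro ⟨i, hi, rfl⟩; omega⟩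
  rw [this, Finset.sum_image (by intro x _ y _ h; simpa using h)]
  refine Finset.sum_congr rfl fun i hi => ?_
  rw [Finset.mem_range] at hi
  rw [zero_add, ncSum_add, ← ncSum_add w (n - i) _ (1 + i)]
  congr 2
  omega

open PowerSeries in
/-- The generating function of `ncSum w w`. -/
noncomputable def ncSeries (w : ℕ → ℝ) : PowerSeries ℝ := PowerSeries.mk (ncSum w w 0)

open PowerSeries in
theorem hasSubst_X_mul (m : PowerSeries ℝ) : HasSubst (X * m : PowerSeries ℝ) :=
  HasSubst.of_constantCoeff_zero' (by simp)

open PowerSeries in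
theorem subst_mk_eq (w : ℕ → ℝ) (v : ℕ → ℝ) :
    (PowerSeries.mk v).subst (X * ncSeries w) =
      PowerSeries.C (v 0) + X * ncSeries w * (PowerSeries.mk fun k => v (k + 1)).subst
        (X * ncSeries w) := by
  have hs := hasSubst_X_mul (ncSeries w)
  conv_lhs => rw [PowerSeries.eq_X_mul_shift_add_const (PowerSeries.mk v)]
  rw [← coe_substAlgHom hs, map_add, map_mul, substAlgHom_X, coe_substAlgHom]
  simp only [coeff_mk, constantCoeff_mk]
  rw [subst_C, add_comm]
  rfl

open PowerSeries in
/-- The functional relation between block weights and sums over noncrossing partitions. -/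
theorem coeff_subst_ncSeries (w : ℕ → ℝ) (n : ℕ) : ∀ v : ℕ → ℝ,
    coeff n ((PowerSeries.mk v).subst (X * ncSeries w)) = if n = 0 then v 0 else ncSum w v 0 n := by
  induction n using Nat.strong_induction_on with
  | _ n ih =>
    intro v
    rw [subst_mk_eq]
    cases n with
    | zero => simp
    | succ n =>
      rw [map_add, mul_assoc, coeff_succ_X_mul, coeff_mul,
        Finset.Nat.sum_antidiagonal_eq_sum_range_succ_mk, Finset.sum_range_succ, ncSum_succ]
      simp only [coeff_C, Nat.succ_ne_zero, if_false, zero_add, ncSeries, coeff_mk]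
      rw [add_comm]
      congr 1
      · have := ih 0 (by omega) (fun k => v (k + 1))
        simp only [ncSeries] at this
        simp [this, mul_comm]
      · refine Finset.sum_congr rfl fun i hi => ?_
        rw [Finset.mem_range] at hi
        have := ih (n - i) (by omega) (fun k => v (k + 1))
        simp only [ncSeries] at this
        rw [this, if_neg (by omega)]

open PowerSeries in
theorem ncSeries_eq_subst (w : ℕ → ℝ) :
    ncSeries w = 1 + X * ncSeries w * (PowerSeries.mk fun k => w (k + 1)).subst
        (X * ncSeries w) := by
  have h := subst_mk_eq w w
  ext n
  have h' := congrArg (coeff n) h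
  rw [coeff_subst_ncSeries, map_add] at h'
  rw [map_add]
  cases n with
  | zero => simp [ncSeries, ncSum_self]
  | succ n => simpa [coeff_C, coeff_one, ncSeries] using h'

open PowerSeries in
theorem ncSeries_of_le_two (a b : ℝ) :
    let N := ncSeries (fun k => if k = 1 then a else if k = 2 then b else 0)
    N = 1 + PowerSeries.C a * X * N + PowerSeries.C b * X ^ 2 * N ^ 2 := by
  intro N
  have h := ncSeries_eq_subst (fun k => if k = 1 then a else if k = 2 then b else 0)
  rw [subst_mk_eq, subst_mk_eq] at h
  have h0 : (PowerSeries.mk fun k => if k + 1 + 1 + 1 = 1 then a else if k + 1 + 1 + 1 = 2 then b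
      else 0) = (0 : PowerSeries ℝ) := by
    ext n
    simp
  have hs := hasSubst_X_mul N
  rw [h0, ← coe_substAlgHom hs, map_zero] at h
  simp only [zero_add, if_true, Nat.reduceAdd, Nat.reduceEqDiff, if_false, mul_zero, add_zero] at h
  change N = 1 + X * N * (PowerSeries.C a + X * N * PowerSeries.C b) at h
  linear_combination h

open PowerSeries in
theorem ncSeries_cumulant (a b : ℝ) (c : ℕ → ℝ) (hc1 : c 1 = 0)
    (hc2 : ∀ k, c (k + 2) =
      ncSum (fun k => if k = 1 then a else if k = 2 then b else 0)
        (fun k => if k = 1 then a else if k = 2 then b else 0) 0 k) :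
    ∃ T : PowerSeries ℝ, ncSeries c = 1 + X ^ 2 * T * ncSeries c ∧
      T = 1 + PowerSeries.C a * X * T + PowerSeries.C (1 + b) * X ^ 2 * T ^ 2 := by
  set N := ncSeries (fun k => if k = 1 then a else if k = 2 then b else 0) with hN
  have h1 := ncSeries_eq_subst c
  have h2 := ncSeries_of_le_two a b
  simp only [← hN] at h2
  have hs := hasSubst_X_mul (ncSeries c)
  have h3 := congrArg (substAlgHom (R := ℝ) hs) h2
  have hC : ∀ r : ℝ, substAlgHom (R := ℝ) hs (PowerSeries.C r) = PowerSeries.C r := fun r => by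
    rw [coe_substAlgHom, subst_C]; rfl
  simp only [map_add, map_mul, map_pow, map_one, substAlgHom_X, hC] at h3
  rw [subst_mk_eq, zero_add, hc1] at h1
  have h4 : (PowerSeries.mk fun k => c (k + 1 + 1)) = N := by
    ext k
    simp [hN, ncSeries, hc2]
  rw [h4, ← coe_substAlgHom hs, map_zero, zero_add] at h1
  set S := substAlgHom (R := ℝ) hs N
  set M := ncSeries c
  refine ⟨M * S, by linear_combination h1, ?_⟩
  rw [map_add, map_one]
  linear_combination S * h1 + h3

theorem meixnerDenom_ne_zero {a b r : ℝ} (hb : 0 < b) (hab : a ^ 2 ≤ 4 * b) (hr : r ^ 2 = 1 + b)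
    {u : ℂ} (hu : ‖u‖ ≤ 1) : (1 + b + r * a * u + b * u ^ 2 : ℂ) ≠ 0 := by
  intro h
  have hn : u.re ^ 2 + u.im ^ 2 ≤ 1 := by
    have h1 := Complex.sq_norm u
    rw [Complex.normSq_apply] at h1
    nlinarith [norm_nonneg u]
  have hre := congrArg Complex.re h
  have him := congrArg Complex.im h
  simp [pow_two] at hre him
  set s := u.re
  set t := u.im
  have him' : t * (r * a + 2 * b * s) = 0 := by linear_combination him
  have hre' : (1 + b) + r * a * s + b * (s ^ 2 - t ^ 2) = 0 := by linear_combination hre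
  rcases mul_eq_zero.1 him' with ht | ht
  · rw [ht] at hre'
    have e : (2 * b * s + r * a) ^ 2 + (1 + b) * (4 * b - a ^ 2) = 0 := by
      linear_combination 4 * b * hre' + a ^ 2 * hr
    have h1 : (2 * b * s + r * a) ^ 2 = 0 := by nlinarith [sq_nonneg (2 * b * s + r * a)]
    have h2 : 2 * b * s + r * a = 0 := by simpa using h1
    have h3 : b * s ^ 2 = 1 + b := by linear_combination s * h2 - hre'
    nlinarith [sq_nonneg t]
  · have h3 : b * (s ^ 2 + t ^ 2) = 1 + b := by linear_combination s * ht - hre'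
    nlinarith

/-- The circle average of `(a + r (u + u⁻¹)) ^ n * u ^ k` against the boundary kernel
`(1 + b) (1 - u²) / (1 + b + r a u + b u²)`. -/
noncomputable def meixnerAverage (a b r : ℝ) (n k : ℕ) : ℂ :=
  Real.circleAverage (fun u : ℂ => (a + r * (u + u⁻¹)) ^ n * u ^ k *
    ((1 + b) * (1 - u ^ 2) / (1 + b + r * a * u + b * u ^ 2))) 0 1

theorem circleIntegrable_meixner {a b r : ℝ} (hb : 0 < b) (hab : a ^ 2 ≤ 4 * b)
    (hr : r ^ 2 = 1 + b) (n k : ℕ) :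
    CircleIntegrable (fun u : ℂ => (a + r * (u + u⁻¹)) ^ n * u ^ k *
    ((1 + b) * (1 - u ^ 2) / (1 + b + r * a * u + b * u ^ 2))) 0 1 := by
  apply ContinuousOn.circleIntegrable zero_le_one
  intro u hu
  have hu1 : ‖u‖ = 1 := by simpa using hu
  have hu0 : u ≠ 0 := by rintro rfl; simp at hu1
  have := meixnerDenom_ne_zero hb hab hr hu1.le
  apply ContinuousAt.continuousWithinAt
  fun_prop (disch := assumption)

theorem meixnerAverage_zero {a b r : ℝ} (hb : 0 < b) (hab : a ^ 2 ≤ 4 * b)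
    (hr : r ^ 2 = 1 + b) (k : ℕ) :
    meixnerAverage a b r 0 k = if k = 0 then 1 else 0 := by
  have hd : DiffContOnCl ℂ (fun u : ℂ => (a + r * (u + u⁻¹)) ^ 0 * u ^ k *
    ((1 + b) * (1 - u ^ 2) / (1 + b + r * a * u + b * u ^ 2))) (Metric.ball 0 |1|) := by
    simp only [pow_zero, one_mul]
    apply DifferentiableOn.diffContOnCl
    rw [abs_one, closure_ball _ one_ne_zero]
    intro u hu
    have := meixnerDenom_ne_zero hb hab hr (u := u) (by simpa using hu)
    apply DifferentiableAt.differentiableWithinAt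
    fun_prop (disch := assumption)
  have hb1 : (1 + b : ℂ) ≠ 0 := by
    have : (1 + b : ℝ) ≠ 0 := by positivity
    exact_mod_cast this
  rw [meixnerAverage, hd.circleAverage]
  rcases k with _ | k
  · simp [div_self hb1]
  · simp

theorem meixnerAverage_succ_succ {a b r : ℝ} (hb : 0 < b) (hab : a ^ 2 ≤ 4 * b)
    (hr : r ^ 2 = 1 + b) (n k : ℕ) :
    meixnerAverage a b r (n + 1) (k + 1) = a * meixnerAverage a b r n (k + 1) +
      r * meixnerAverage a b r n (k + 2) + r * meixnerAverage a b r n k := by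
  have hi := circleIntegrable_meixner hb hab hr
  simp only [meixnerAverage, ← smul_eq_mul (a := (a : ℂ)), ← smul_eq_mul (a := (r : ℂ))]
  rw [← Real.circleAverage_fun_smul, ← Real.circleAverage_fun_smul, ← Real.circleAverage_fun_smul,
    ← Real.circleAverage_fun_add, ← Real.circleAverage_fun_add]
  · apply Real.circleAverage_congr_sphere
    intro u hu
    have hu0 : u ≠ 0 := by rintro rfl; simp at hu
    simp only [smul_eq_mul]
    linear_combination r * (a + r * (u + u⁻¹)) ^ n * u ^ k *
      ((1 + b) * (1 - u ^ 2) / (1 + b + r * a * u + b * u ^ 2)) * mul_inv_cancel₀ hu0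
  · exact ((hi n (k + 1)).const_smul (a := (a : ℂ))).add ((hi n (k + 2)).const_smul (a := (r : ℂ)))
  · exact (hi n k).const_smul (a := (r : ℂ))
  · exact (hi n (k + 1)).const_smul (a := (a : ℂ))
  · exact (hi n (k + 2)).const_smul (a := (r : ℂ))

theorem meixnerAverage_succ_zero {a b r : ℝ} (hb : 0 < b) (hab : a ^ 2 ≤ 4 * b)
    (hr : r ^ 2 = 1 + b) (hr0 : r ≠ 0) (n : ℕ) :
    meixnerAverage a b r (n + 1) 0 = (r : ℂ)⁻¹ * meixnerAverage a b r n 1 := by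
  have hi := circleIntegrable_meixner hb hab hr
  have hrc : (r : ℂ) ≠ 0 := by exact_mod_cast hr0
  have hrc2 : (r : ℂ) ^ 2 = 1 + b := by exact_mod_cast hr
  have hodd : Real.circleAverage (fun u : ℂ => (a + r * (u + u⁻¹)) ^ n * (u⁻¹ - u)) 0 1 = 0 := by
    have h := Real.circleAverage_zero_one_congr_inv
      (f := fun u : ℂ => (a + r * (u + u⁻¹)) ^ n * (u⁻¹ - u))
    have h2 : (fun u : ℂ => (a + r * (u⁻¹ + u⁻¹⁻¹)) ^ n * (u⁻¹⁻¹ - u⁻¹)) =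
        fun u : ℂ => (-1 : ℂ) • ((a + r * (u + u⁻¹)) ^ n * (u⁻¹ - u)) := by
      ext u
      rw [inv_inv, add_comm u⁻¹ u, smul_eq_mul]
      ring
    rw [h2, Real.circleAverage_fun_smul] at h
    simp only [neg_smul, one_smul] at h
    exact self_eq_neg.1 h.symm
  have hio : CircleIntegrable (fun u : ℂ => (a + r * (u + u⁻¹)) ^ n * (u⁻¹ - u)) 0 1 := by
    apply ContinuousOn.circleIntegrable zero_le_one
    intro u hu
    have hu0 : u ≠ 0 := by rintro rfl; simp at hu
    apply ContinuousAt.continuousWithinAt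
    fun_prop (disch := assumption)
  have hsum : meixnerAverage a b r (n + 1) 0 = (r : ℂ)⁻¹ • meixnerAverage a b r n 1 + (r : ℂ) •
      Real.circleAverage (fun u : ℂ => (a + r * (u + u⁻¹)) ^ n * (u⁻¹ - u)) 0 1 := by
    simp only [meixnerAverage]
    rw [← Real.circleAverage_fun_smul, ← Real.circleAverage_fun_smul,
      ← Real.circleAverage_fun_add]
    · apply Real.circleAverage_congr_sphere
      intro u hu
      have hu1 : ‖u‖ = 1 := by simpa using hu
      have hu0 : u ≠ 0 := by rintro rfl; simp at hu
      have hD := meixnerDenom_ne_zero hb hab hr hu1.le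
      simp only [smul_eq_mul, pow_zero, pow_one, mul_one]
      have key : (a + r * (u + u⁻¹)) * ((1 + b) * (1 - u ^ 2) / (1 + b + r * a * u + b * u ^ 2)) =
          (r : ℂ)⁻¹ * u * ((1 + b) * (1 - u ^ 2) / (1 + b + r * a * u + b * u ^ 2)) +
          r * (u⁻¹ - u) := by
        have hK := div_mul_cancel₀ ((1 + b) * (1 - u ^ 2) : ℂ) hD
        set K := ((1 + b) * (1 - u ^ 2) / (1 + b + r * a * u + b * u ^ 2) : ℂ)
        apply mul_left_cancel₀ (mul_ne_zero hu0 hrc)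
        linear_combination hK + r ^ 2 * (K - 1) * mul_inv_cancel₀ hu0 -
          u ^ 2 * K * mul_inv_cancel₀ hrc + (u ^ 2 * K + K - 1 + u ^ 2) * hrc2
      linear_combination (a + r * (u + u⁻¹)) ^ n * key
    · exact (hi n 1).const_smul (a := (r : ℂ)⁻¹)
    · exact hio.const_smul (a := (r : ℂ))
  rw [hsum, hodd, smul_zero, add_zero, smul_eq_mul]

open PowerSeries in
theorem meixnerAverage_eq_coeff {a b r : ℝ} (hb : 0 < b) (hab : a ^ 2 ≤ 4 * b)
    (hr : r ^ 2 = 1 + b) (hr0 : r ≠ 0) {M T : PowerSeries ℝ} (hM : M = 1 + X ^ 2 * T * M)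
    (hT : T = 1 + PowerSeries.C a * X * T + PowerSeries.C (1 + b) * X ^ 2 * T ^ 2) (n k : ℕ) :
    meixnerAverage a b r n k =
      ((PowerSeries.coeff n ((PowerSeries.C r * X * T) ^ k * M) : ℝ) : ℂ) := by
  induction n generalizing k with
  | zero =>
    rw [meixnerAverage_zero hb hab hr]
    have hM0 : constantCoeff M = 1 := by rw [hM]; simp
    rcases k with _ | k
    · simp [hM0]
    · simp
  | succ n ih =>
    have hC : (PowerSeries.C r : PowerSeries ℝ) * PowerSeries.C r⁻¹ = 1 := by
      rw [← map_mul, mul_inv_cancel₀ hr0, map_one]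
    rcases k with _ | k
    · rw [meixnerAverage_succ_zero hb hab hr hr0, ih, pow_zero, one_mul]
      have : M = 1 + X * (PowerSeries.C r⁻¹ * ((PowerSeries.C r * X * T) ^ 1 * M)) := by
        linear_combination hM - X ^ 2 * T * M * hC
      conv_rhs => rw [this]
      rw [map_add, coeff_succ_X_mul, coeff_C_mul]
      simp [coeff_one]
    · rw [meixnerAverage_succ_succ hb hab hr, ih, ih, ih]
      have hr2 : (PowerSeries.C r : PowerSeries ℝ) ^ 2 = PowerSeries.C (1 + b) := by
        rw [← map_pow, hr]
      have : (PowerSeries.C r * X * T) ^ (k + 1) * M =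
          X * (PowerSeries.C a * ((PowerSeries.C r * X * T) ^ (k + 1) * M) +
            PowerSeries.C r * ((PowerSeries.C r * X * T) ^ (k + 2) * M) +
            PowerSeries.C r * ((PowerSeries.C r * X * T) ^ k * M)) := by
        linear_combination PowerSeries.C r * X * (PowerSeries.C r * X * T) ^ k * M * hT
          - PowerSeries.C r * X * (PowerSeries.C r * X * T) ^ k * M * X ^ 2 * T ^ 2 * hr2
      conv_rhs => rw [this]
      rw [coeff_succ_X_mul, map_add, map_add, coeff_C_mul, coeff_C_mul, coeff_C_mul]
      push_cast
      ring

theorem meixnerQuadratic_ne_zero_s12 {a b x : ℝ} (hab : a ^ 2 ≤ 4 * b)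
    (hx : (x - a) ^ 2 ≤ 4 * (1 + b)) : b * x ^ 2 + a * x + 1 ≠ 0 := by
  intro h
  have e : (2 * b * x + a) ^ 2 + (4 * b - a ^ 2) = 0 := by linear_combination 4 * b * h
  have h1 : (2 * b * x + a) ^ 2 = 0 := by nlinarith [sq_nonneg (2 * b * x + a)]
  have h2 : 2 * b * x + a = 0 := by simpa using h1
  have ha : a = -(2 * b * x) := by linarith
  have h3 : b * x ^ 2 = 1 := by rw [ha] at h; linarith
  have h4 : b * (x - a) ^ 2 = (1 + 2 * b) ^ 2 := by
    rw [ha]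
    linear_combination (1 + 2 * b) ^ 2 * h3
  nlinarith

theorem meixnerQuadratic_cos_ne_zero {a b r : ℝ} (hab : a ^ 2 ≤ 4 * b) (hr : r ^ 2 = 1 + b)
    (θ : ℝ) :
    b * (a + 2 * r * Real.cos θ) ^ 2 + a * (a + 2 * r * Real.cos θ) + 1 ≠ 0 := by
  apply meixnerQuadratic_ne_zero_s12 hab
  have h := Real.cos_sq_le_one θ
  nlinarith

/-- The density after the substitution `x = a + 2 r cos θ`. -/
noncomputable def meixnerAngular (a b r : ℝ) (n : ℕ) (θ : ℝ) : ℝ :=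
  (a + 2 * r * Real.cos θ) ^ n * (4 * (1 + b) * Real.sin θ ^ 2 /
    (2 * Real.pi * (b * (a + 2 * r * Real.cos θ) ^ 2 + a * (a + 2 * r * Real.cos θ) + 1)))

theorem continuous_meixnerAngular {a b r : ℝ} (hab : a ^ 2 ≤ 4 * b)
    (hr : r ^ 2 = 1 + b) (n : ℕ) :
    Continuous (meixnerAngular a b r n) := by
  have h1 := meixnerQuadratic_cos_ne_zero hab hr
  have h2 : ∀ θ, 2 * Real.pi *
      (b * (a + 2 * r * Real.cos θ) ^ 2 + a * (a + 2 * r * Real.cos θ) + 1) ≠ 0 := fun θ =>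
    mul_ne_zero (by positivity) (h1 θ)
  unfold meixnerAngular
  fun_prop (disch := exact h2 _)

theorem integral_meixnerAngular_two_pi {a b r : ℝ} (hab : a ^ 2 ≤ 4 * b)
    (hr : r ^ 2 = 1 + b) (n : ℕ) :
    ∫ θ in 0..2 * Real.pi, meixnerAngular a b r n θ =
      2 * ∫ θ in 0..Real.pi, meixnerAngular a b r n θ := by
  have hc := continuous_meixnerAngular hab hr n
  have hs : ∀ θ, meixnerAngular a b r n (2 * Real.pi - θ) = meixnerAngular a b r n θ := by
    intro θ
    simp [meixnerAngular, Real.cos_two_pi_sub, Real.sin_two_pi_sub]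
  have h := intervalIntegral.integral_comp_sub_left (a := 0) (b := Real.pi)
    (meixnerAngular a b r n) (2 * Real.pi)
  simp only [hs, sub_zero] at h
  rw [show 2 * Real.pi - Real.pi = Real.pi by ring] at h
  rw [← intervalIntegral.integral_add_adjacent_intervals (hc.intervalIntegrable 0 Real.pi)
    (hc.intervalIntegrable Real.pi (2 * Real.pi)), ← h]
  ring

theorem integral_freeMeixnerDensity_eq {a b r : ℝ} (hab : a ^ 2 ≤ 4 * b)
    (hr : r ^ 2 = 1 + b) (hr0 : 0 < r) (n : ℕ) :
    ∫ x : ℝ, x ^ n * freeMeixnerDensity a b x =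
      ∫ θ in 0..Real.pi, meixnerAngular a b r n θ := by
  have hsq : Real.sqrt (1 + b) = r := by rw [← hr, Real.sqrt_sq hr0.le]
  set g : ℝ → ℝ := fun x => x ^ n *
    (Real.sqrt (4 * (1 + b) - (x - a) ^ 2) / (2 * Real.pi * (b * x ^ 2 + a * x + 1))) with hg
  have h1 : (fun x : ℝ => x ^ n * freeMeixnerDensity a b x) =
      (Set.Icc (a - 2 * r) (a + 2 * r)).indicator g := by
    ext x
    simp only [freeMeixnerDensity, hsq, Set.indicator_apply, hg]
    split_ifs <;> simp
  rw [h1, integral_indicator measurableSet_Icc, integral_Icc_eq_integral_Ioc,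
    ← intervalIntegral.integral_of_le (by linarith)]
  have hsub := intervalIntegral.integral_comp_mul_deriv'' (a := 0) (b := Real.pi)
    (f := fun θ => a + 2 * r * Real.cos θ) (f' := fun θ => 2 * r * -Real.sin θ) (g := g)
    (by fun_prop)
    (fun θ _ => (((Real.hasDerivAt_cos θ).const_mul (2 * r)).const_add a).hasDerivWithinAt)
    (by fun_prop)
    (by
      rintro _ ⟨θ, -, rfl⟩
      have h2 := meixnerQuadratic_cos_ne_zero hab hr θ
      have h3 : 2 * Real.pi * (b * (a + 2 * r * Real.cos θ) ^ 2 +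
        a * (a + 2 * r * Real.cos θ) + 1) ≠ 0 := mul_ne_zero (by positivity) h2
      apply ContinuousAt.continuousWithinAt
      fun_prop (disch := assumption))
  simp only [Real.cos_zero, Real.cos_pi, mul_one, mul_neg, ← sub_eq_add_neg] at hsub
  rw [intervalIntegral.integral_symm, ← hsub, ← intervalIntegral.integral_neg]
  apply intervalIntegral.integral_congr
  intro θ hθ
  rw [Set.uIcc_of_le Real.pi_pos.le] at hθ
  have hsin := Real.sin_nonneg_of_mem_Icc hθ
  have hroot : Real.sqrt (4 * (1 + b) - (a + 2 * r * Real.cos θ - a) ^ 2) = 2 * r * Real.sin θ := by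
    rw [← Real.sqrt_sq (show 0 ≤ 2 * r * Real.sin θ by positivity)]
    congr 1
    linear_combination -4 * hr - 4 * r ^ 2 * Real.sin_sq_add_cos_sq θ
  simp only [Function.comp_apply, hg, meixnerAngular, hroot]
  rw [← hr]
  ring

theorem meixnerAverage_eq_integral {a b r : ℝ} (hb : 0 < b) (hab : a ^ 2 ≤ 4 * b)
    (hr : r ^ 2 = 1 + b) (n : ℕ) :
    meixnerAverage a b r n 0 = ((∫ θ in 0..Real.pi, meixnerAngular a b r n θ : ℝ) : ℂ) := by
  have hi := circleIntegrable_meixner hb hab hr n 0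
  have hinv := Real.circleAverage_zero_one_congr_inv (f := fun u : ℂ => (a + r * (u + u⁻¹)) ^ n *
    u ^ 0 * ((1 + b) * (1 - u ^ 2) / (1 + b + r * a * u + b * u ^ 2)))
  have hi' : CircleIntegrable (fun u : ℂ => (a + r * (u⁻¹ + u⁻¹⁻¹)) ^ n *
    u⁻¹ ^ 0 * ((1 + b) * (1 - u⁻¹ ^ 2) / (1 + b + r * a * u⁻¹ + b * u⁻¹ ^ 2))) 0 1 := by
    apply ContinuousOn.circleIntegrable zero_le_one
    intro u hu
    have hu1 : ‖u‖ = 1 := by simpa using hu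
    have hu0 : u ≠ 0 := by rintro rfl; simp at hu1
    have hu0' : u⁻¹ ≠ 0 := inv_ne_zero hu0
    have := meixnerDenom_ne_zero hb hab hr (u := u⁻¹) (by simp [hu1])
    apply ContinuousAt.continuousWithinAt
    fun_prop (disch := assumption)
  have hadd := Real.circleAverage_fun_add hi hi'
  rw [hinv] at hadd
  have hdef : meixnerAverage a b r n 0 = Real.circleAverage (fun u : ℂ => (a + r * (u + u⁻¹)) ^ n *
    u ^ 0 * ((1 + b) * (1 - u ^ 2) / (1 + b + r * a * u + b * u ^ 2))) 0 1 := rfl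
  rw [← hdef, Real.circleAverage] at hadd
  have hrc2 : (r : ℂ) ^ 2 = 1 + b := by exact_mod_cast hr
  have hpt : ∀ θ : ℝ, (fun u : ℂ => (a + r * (u + u⁻¹)) ^ n *
      u ^ 0 * ((1 + b) * (1 - u ^ 2) / (1 + b + r * a * u + b * u ^ 2)) +
      (a + r * (u⁻¹ + u⁻¹⁻¹)) ^ n * u⁻¹ ^ 0 *
        ((1 + b) * (1 - u⁻¹ ^ 2) / (1 + b + r * a * u⁻¹ + b * u⁻¹ ^ 2))) (circleMap 0 1 θ) =
      ((2 * Real.pi * meixnerAngular a b r n θ : ℝ) : ℂ) := by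
    intro θ
    have hpi : (Real.pi : ℂ) ≠ 0 := by exact_mod_cast Real.pi_ne_zero
    have hu1 : ‖circleMap 0 1 θ‖ = 1 := by simp
    have hu0 : circleMap 0 1 θ ≠ 0 := by intro h; simp [h] at hu1
    have hD := meixnerDenom_ne_zero hb hab hr hu1.le
    have hD' := meixnerDenom_ne_zero hb hab hr (u := (circleMap 0 1 θ)⁻¹) (by simp)
    have he : circleMap 0 1 θ = Real.cos θ + Real.sin θ * Complex.I := by
      simp [circleMap, Complex.exp_mul_I]
    have he' : (circleMap 0 1 θ)⁻¹ = Real.cos θ - Real.sin θ * Complex.I := by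
      have hcs : (Real.cos θ : ℂ) ^ 2 + (Real.sin θ : ℂ) ^ 2 = 1 := by
        exact_mod_cast Real.cos_sq_add_sin_sq θ
      apply inv_eq_of_mul_eq_one_right
      rw [he]
      linear_combination hcs - (Real.sin θ : ℂ) ^ 2 * Complex.I_sq
    have hsum : circleMap 0 1 θ + (circleMap 0 1 θ)⁻¹ = 2 * Real.cos θ := by
      rw [he', he]
      ring
    have hdiff : (circleMap 0 1 θ - (circleMap 0 1 θ)⁻¹) ^ 2 = -4 * Real.sin θ ^ 2 := by
      rw [he', he]
      linear_combination 4 * (Real.sin θ : ℂ) ^ 2 * Complex.I_sq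
    clear he he'
    simp only [meixnerAngular, inv_inv, pow_zero, mul_one]
    push_cast
    simp only [← Complex.ofReal_cos, ← Complex.ofReal_sin]
    generalize circleMap 0 1 θ = u at *
    generalize hv : u⁻¹ = v at *
    have huv : u * v = 1 := by rw [← hv, mul_inv_cancel₀ hu0]
    rw [add_comm v u, hsum, ← mul_add]
    have hqq : (b * (a + 2 * r * Real.cos θ) ^ 2 + a * (a + 2 * r * Real.cos θ) + 1 : ℂ) =
        (1 + b + r * a * u + b * u ^ 2) * (1 + b + r * a * v + b * v ^ 2) := by
      rw [show (2 * r * Real.cos θ : ℂ) = r * (u + v) by rw [hsum]; ring]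
      linear_combination (b * (u + v) ^ 2 - a ^ 2) * hrc2 - (r ^ 2 * a ^ 2 + r * a * b * (u + v) +
        b ^ 2 * (u * v + 1) - 2 * (1 + b) * b) * huv
    have hnum : (1 - u ^ 2) * (1 + b + r * a * v + b * v ^ 2) +
        (1 - v ^ 2) * (1 + b + r * a * u + b * u ^ 2) = 4 * (Real.sin θ : ℂ) ^ 2 := by
      linear_combination -hdiff - (2 + r * a * (u + v) + 2 * b * (u * v + 1)) * huv
    rw [hqq, div_add_div _ _ hD hD', show (1 + b) * (1 - u ^ 2) * (1 + b + r * a * v + b * v ^ 2) +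
      (1 + b + r * a * u + b * u ^ 2) * ((1 + b) * (1 - v ^ 2)) =
      (4 * (1 + b) * (Real.sin θ : ℂ) ^ 2) by linear_combination (1 + b) * hnum,
      show (a + r * (2 * Real.cos θ) : ℂ) = a + 2 * r * Real.cos θ by ring]
    field_simp
  simp_rw [hpt] at hadd
  rw [intervalIntegral.integral_ofReal, intervalIntegral.integral_const_mul,
    integral_meixnerAngular_two_pi hab hr] at hadd
  push_cast at hadd ⊢
  have hpi : (Real.pi : ℂ) ≠ 0 := by exact_mod_cast Real.pi_ne_zero
  rw [Complex.real_smul] at hadd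
  push_cast at hadd
  field_simp at hadd
  linear_combination -hadd / 2

/-- The blocks of a partition of `Fin n`, as sets of natural numbers. -/
def natParts {n : ℕ} (V : Finpartition (Finset.univ : Finset (Fin n))) : Finset (Finset ℕ) :=
  V.parts.image (Finset.map Fin.valEmbedding)

theorem natParts_injective (n : ℕ) : Function.Injective (natParts (n := n)) := by
  intro V W h
  exact Finpartition.ext (Finset.image_injective (Finset.map_injective _) h)

theorem prod_natParts {n : ℕ} (w : ℕ → ℝ) (V : Finpartition (Finset.univ : Finset (Fin n))) :
    ∏ B ∈ natParts V, w B.card = ∏ B ∈ V.parts, w B.card := by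
  rw [natParts, Finset.prod_image fun _ _ _ _ h => Finset.map_injective _ h]
  simp

theorem isNCPartition_natParts {n : ℕ} {V : Finpartition (Finset.univ : Finset (Fin n))}
    (hV : IsNoncrossing V) : IsNCPartition 0 n (natParts V) := by
  simp only [natParts]
  refine ⟨?_, ?_, ?_, ?_, ?_⟩
  · simp only [Finset.mem_image, forall_exists_index, and_imp]
    rintro _ B hB rfl
    obtain ⟨x, hx⟩ := V.nonempty_of_mem_parts hB
    exact ⟨x, Finset.mem_map_of_mem _ hx⟩
  · simp only [Finset.mem_image, forall_exists_index, and_imp]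
    rintro _ B hB rfl x hx
    obtain ⟨y, -, rfl⟩ := Finset.mem_map.1 hx
    exact ⟨Nat.zero_le _, y.2⟩
  · intro x _ hx
    obtain ⟨B, hB, hxB⟩ := V.exists_mem (Finset.mem_univ (⟨x, hx⟩ : Fin n))
    exact ⟨_, Finset.mem_image_of_mem _ hB, Finset.mem_map.2 ⟨_, hxB, rfl⟩⟩
  · simp only [Finset.mem_image, forall_exists_index, and_imp]
    rintro _ B hB rfl _ B' hB' rfl x hx hx'
    obtain ⟨y, hy, rfl⟩ := Finset.mem_map.1 hx
    obtain ⟨z, hz, hzy⟩ := Finset.mem_map.1 hx'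
    obtain rfl := Fin.val_injective hzy
    rw [V.eq_of_mem_parts hB hB' hy hz]
  · simp only [Finset.mem_image, forall_exists_index, and_imp]
    rintro _ B hB rfl _ B' hB' rfl i₁ j₁ i₂ j₂ h1 h2 h3 hi₁ hi₂ hj₁ hj₂
    obtain ⟨i₁, hi₁', rfl⟩ := Finset.mem_map.1 hi₁
    obtain ⟨i₂, hi₂', rfl⟩ := Finset.mem_map.1 hi₂
    obtain ⟨j₁, hj₁', rfl⟩ := Finset.mem_map.1 hj₁
    obtain ⟨j₂, hj₂', rfl⟩ := Finset.mem_map.1 hj₂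
    by_contra hne
    exact hV ⟨i₁, j₁, i₂, j₂, h1, h2, h3, B, hB, B', hB', fun h => hne (by rw [h]),
      hi₁', hi₂', hj₁', hj₂'⟩

theorem exists_natParts_eq {n : ℕ} {P : Finset (Finset ℕ)} (hP : IsNCPartition 0 n P) :
    ∃ V : Finpartition (Finset.univ : Finset (Fin n)), IsNoncrossing V ∧ natParts V = P := by
  set Q : Finset (Finset (Fin n)) :=
    Finset.univ.filter fun B => B.map Fin.valEmbedding ∈ P with hQ
  have hmem : ∀ B, B ∈ Q ↔ B.map Fin.valEmbedding ∈ P := by simp [hQ]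
  have hval : ∀ {B : Finset (Fin n)} {x : Fin n}, (x : ℕ) ∈ B.map Fin.valEmbedding ↔ x ∈ B := by
    intro B x
    exact Finset.mem_map' Fin.valEmbedding
  have hsurj : ∀ C ∈ P, ∃ B ∈ Q, B.map Fin.valEmbedding = C := by
    intro C hC
    have : (Finset.univ.filter fun x : Fin n => (x : ℕ) ∈ C).map Fin.valEmbedding = C := by
      ext x
      simp only [Finset.mem_map, Finset.mem_filter, Finset.mem_univ, true_and]
      constructor
      · rintro ⟨y, hy, rfl⟩
        exact hy
      · exact fun hx => ⟨⟨x, (hP.mem_Ico C hC x hx).2⟩, hx, rfl⟩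
    exact ⟨_, (hmem _).2 (by rwa [this]), this⟩
  refine ⟨Finpartition.ofExistsUnique Q (fun _ _ => Finset.subset_univ _) ?_ ?_, ?_, ?_⟩
  · intro x _
    obtain ⟨C, hC, hxC⟩ := hP.cover x (Nat.zero_le _) x.2
    obtain ⟨B, hB, rfl⟩ := hsurj C hC
    refine ⟨B, ⟨hB, hval.1 hxC⟩, ?_⟩
    rintro B' ⟨hB', hx'⟩
    exact Finset.map_injective _ (hP.unique _ ((hmem _).1 hB') _ hC x (hval.2 hx') hxC)
  · intro h
    obtain ⟨x, hx⟩ := hP.nonempty _ ((hmem _).1 h)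
    simp at hx
  · rintro ⟨i₁, j₁, i₂, j₂, h1, h2, h3, B, hB, B', hB', hne, hi₁, hi₂, hj₁, hj₂⟩
    exact hne (Finset.map_injective _ (hP.noncrossing _ ((hmem _).1 hB) _ ((hmem _).1 hB')
      i₁ j₁ i₂ j₂ h1 h2 h3 (hval.2 hi₁) (hval.2 hi₂) (hval.2 hj₁) (hval.2 hj₂)))
  · ext C
    simp only [natParts, Finset.mem_image]
    constructor
    · rintro ⟨B, hB, rfl⟩
      exact (hmem _).1 hB
    · exact hsurj C

theorem finsum_isNoncrossing (w : ℕ → ℝ) (n : ℕ) :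
    ∑ᶠ V ∈ {V : Finpartition (Finset.univ : Finset (Fin n)) | IsNoncrossing V},
      ∏ B ∈ V.parts, w B.card = ncSum w w 0 n := by
  classical
  rw [ncSum_same, finsum_mem_eq_finite_toFinset_sum _ (Set.toFinite _)]
  refine Finset.sum_bij (fun V _ => natParts V) ?_ ?_ ?_ ?_
  · intro V hV
    exact mem_ncPartitions.2 (isNCPartition_natParts (by simpa using hV))
  · exact fun V _ W _ h => natParts_injective n h
  · intro P hP
    obtain ⟨V, hV, rfl⟩ := exists_natParts_eq (mem_ncPartitions.1 hP)
    exact ⟨V, by simpa using hV, rfl⟩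
  · exact fun V _ => (prod_natParts w V).symm

theorem finsum_isNoncrossing_le_two (a b : ℝ) (n : ℕ) :
    ∑ᶠ W ∈ {W : Finpartition (Finset.univ : Finset (Fin n)) |
        IsNoncrossing W ∧ ∀ B ∈ W.parts, B.card ≤ 2},
      a ^ singletonCount W * b ^ (W.parts.card - singletonCount W) =
    ncSum (fun k => if k = 1 then a else if k = 2 then b else 0)
      (fun k => if k = 1 then a else if k = 2 then b else 0) 0 n := by
  classical
  rw [← finsum_isNoncrossing, finsum_mem_eq_finite_toFinset_sum _ (Set.toFinite _),
    finsum_mem_eq_finite_toFinset_sum _ (Set.toFinite _)]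
  apply Finset.sum_subset_zero_on_sdiff
  · intro V
    simpa using fun h _ => h
  · intro V hV
    simp only [Finset.mem_sdiff, Set.Finite.mem_toFinset, Set.mem_ofPred_eq, not_and, not_forall]
      at hV
    obtain ⟨B, hB, h⟩ := hV.2 hV.1
    exact Finset.prod_eq_zero hB (by rw [if_neg (by omega), if_neg (by omega)])
  · intro V hV
    have hV2 : ∀ B ∈ V.parts, B.card ≤ 2 := by
      simp only [Set.Finite.mem_toFinset, Set.mem_ofPred_eq] at hV
      exact hV.2
    have h := Finset.card_filter_add_card_filter_not (s := V.parts) (fun B => B.card = 1)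
    have h2 : V.parts.card - singletonCount V =
        (V.parts.filter fun B => ¬ B.card = 1).card := by
      rw [singletonCount]
      omega
    rw [h2, singletonCount, Finset.prod_ite, Finset.prod_const]
    congr 1
    rw [← Finset.prod_const]
    apply Finset.prod_congr rfl
    intro B hB
    rw [Finset.mem_filter] at hB
    have h3 := hV2 B hB.1
    have h4 := (V.nonempty_of_mem_parts hB.1).card_pos
    rw [if_pos (by omega)]

/-- **Moment–cumulant formula for the free Meixner law.** With free cumulants
`c 1 = 0` and `c (k+2) = ∑_{W ∈ NC_{≤2}(k)} a^{s(W)} b^{|W|-s(W)}`, the `n`-th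
moment of the free Meixner law equals `∑_{V ∈ NC(n)} ∏_{B ∈ V} c |B|`. -/
theorem stmt_12 (a b : ℝ) (hb : 0 < b) (hab : a ^ 2 ≤ 4 * b)
    (c : ℕ → ℝ) (hc1 : c 1 = 0)
    (hc2 : ∀ k : ℕ, c (k + 2) =
      ∑ᶠ W ∈ {W : Finpartition (Finset.univ : Finset (Fin k)) |
          IsNoncrossing W ∧ ∀ B ∈ W.parts, B.card ≤ 2},
        a ^ singletonCount W * b ^ (W.parts.card - singletonCount W)) :
    ∀ n : ℕ, 1 ≤ n →
      ∫ x : ℝ, x ^ n * freeMeixnerDensity a b x =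
        ∑ᶠ V ∈ {V : Finpartition (Finset.univ : Finset (Fin n)) | IsNoncrossing V},
          ∏ B ∈ V.parts, c B.card := by
  intro n _
  obtain ⟨T, hM, hT⟩ := ncSeries_cumulant a b c hc1 fun k => by
    rw [hc2, finsum_isNoncrossing_le_two]
  have hr : Real.sqrt (1 + b) ^ 2 = 1 + b := Real.sq_sqrt (by positivity)
  have hr0 : 0 < Real.sqrt (1 + b) := Real.sqrt_pos.2 (by positivity)
  have h := meixnerAverage_eq_coeff hb hab hr hr0.ne' hM hT n 0
  rw [meixnerAverage_eq_integral hb hab hr, pow_zero, one_mul, Complex.ofReal_inj, ncSeries,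
    PowerSeries.coeff_mk] at h
  rw [integral_freeMeixnerDensity_eq hab hr hr0, h, finsum_isNoncrossing]
end
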